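/- Let Ω be a bounded open set in ℝ^d with d ≥ 2, T > 0, ε > 0, 1 ≤ p ≤ 2 ≤ q ≤ ∞ with p < d, and s > 2. Let g be a bounded measurable function of (x,t;y,τ) on Ω_T×ℝ^{d+1}, 1-periodic in (y,τ), with [g]_{𝓗(Ω_T;L^∞)} < ∞; let f, h be measurable, 1-periodic in (y,τ), with the norms below finite; and let ψ ∈ C_c^∞(Ω_T). Then ‖{S_ε([g·S_ε(h) − S_ε(g·h)]·f)}^ε · ψ‖_{L¹(Ω_T∖Ω_T^{1,ε})} ≤ C ε [g]_{𝓗(Ω_T;L^∞)} ‖h‖_{L^∞(Ω_T;L^{s,2})} { ‖f‖_{L^{2,p*}(Ω_T;L^∞)} ‖ψ‖_{L^{2,p'}(Ω_T)} + ‖f‖_{L^{2q/(q−2),2}(Ω_T;L^∞)} ‖ψ‖_{L^{q,2}(Ω_T)} }, where p* = dp/(d−p), p' = p/(p−1), and C depends only on d, q, s. -/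

import Mathlib

open MeasureTheory ENNReal Set

noncomputable section

abbrev Esp (d : ℕ) : Type := EuclideanSpace ℝ (Fin d)

/-- `L^p` "norm" (in `ℝ≥0∞`) of an `ℝ≥0∞`-valued function, essential-sup for `p = ∞`. -/
def eLp {α : Type*} [MeasurableSpace α] (p : ℝ≥0∞) (μ : Measure α) (f : α → ℝ≥0∞) : ℝ≥0∞ :=
  if p = ∞ then essSup f μ else (∫⁻ x, f x ^ p.toReal ∂μ) ^ (1 / p.toReal)

/-- Unit periodicity cell `[0,1]^d`. -/
def unitCell (d : ℕ) : Set (Esp d) := {y | ∀ i, y i ∈ Icc (0:ℝ) 1}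

/-- `L^{s,r}` norm over the unit periodicity cell (`τ` outer, `y` inner);
`s = r = ∞` gives the essential supremum over the cell. -/
def cellNorm {d : ℕ} (s r : ℝ≥0∞) (g : Esp d → ℝ → ℝ) : ℝ≥0∞ :=
  eLp s (volume.restrict (Ioc (0:ℝ) 1)) fun τ =>
    eLp r (volume.restrict (unitCell d)) fun y => (‖g y τ‖₊ : ℝ≥0∞)

/-- Mixed `L^{q,p}` norm (`t` outer, `x` inner) over a space-time region `A`. -/
def mixNorm {d : ℕ} (q p : ℝ≥0∞) (A : Set (Esp d × ℝ)) (F : Esp d → ℝ → ℝ≥0∞) : ℝ≥0∞ :=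
  eLp q volume fun t => eLp p (volume.restrict {x | (x, t) ∈ A}) fun x => F x t

/-- 1-periodicity in the microscopic variables `(y,τ)`. -/
def Per4 {d : ℕ} (g : Esp d → ℝ → Esp d → ℝ → ℝ) : Prop :=
  ∀ x t y τ, (∀ i, g x t (y + EuclideanSpace.single i 1) τ = g x t y τ) ∧
    g x t y (τ + 1) = g x t y τ

def Meas4 {d : ℕ} (g : Esp d → ℝ → Esp d → ℝ → ℝ) : Prop :=
  Measurable fun w : (Esp d × ℝ) × Esp d × ℝ => g w.1.1 w.1.2 w.2.1 w.2.2

/-- Time smoothing `S^t_ε` of a four-variable function. -/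
def St4 {d : ℕ} (φ₁ : ℝ → ℝ) (ε : ℝ) (g : Esp d → ℝ → Esp d → ℝ → ℝ) :
    Esp d → ℝ → Esp d → ℝ → ℝ :=
  fun x t y τ => ∫ s : ℝ, g x (t - s) y τ * ((ε ^ 2)⁻¹ * φ₁ (s / ε ^ 2))

/-- Space smoothing `S^x_ε` of a four-variable function. -/
def Sx4 {d : ℕ} (φ₂ : Esp d → ℝ) (ε : ℝ) (g : Esp d → ℝ → Esp d → ℝ → ℝ) :
    Esp d → ℝ → Esp d → ℝ → ℝ :=
  fun x t y τ => ∫ z : Esp d, g (x - z) t y τ * ((ε ^ d)⁻¹ * φ₂ (ε⁻¹ • z))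

/-- `S_ε = S^t_ε ∘ S^x_ε`. -/
def S4 {d : ℕ} (φ₁ : ℝ → ℝ) (φ₂ : Esp d → ℝ) (ε : ℝ) (g : Esp d → ℝ → Esp d → ℝ → ℝ) :
    Esp d → ℝ → Esp d → ℝ → ℝ :=
  St4 φ₁ ε (Sx4 φ₂ ε g)

/-- `g^ε(x,t) := g(x,t; x/ε, t/ε²)`. -/
def osc4 {d : ℕ} (ε : ℝ) (g : Esp d → ℝ → Esp d → ℝ → ℝ) : Esp d → ℝ → ℝ :=
  fun x t => g x t (ε⁻¹ • x) (t / ε ^ 2)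

/-- Smooth nonnegative normalized kernel supported in `(-1/2,1/2)`. -/
def GoodK1 (φ₁ : ℝ → ℝ) : Prop :=
  ContDiff ℝ (⊤ : ℕ∞) φ₁ ∧ HasCompactSupport φ₁ ∧ tsupport φ₁ ⊆ Ioo (-(1/2) : ℝ) (1/2) ∧
    (∀ s, 0 ≤ φ₁ s) ∧ (∫ s : ℝ, φ₁ s) = 1

/-- Smooth nonnegative normalized kernel supported in the ball `B(0,1/2) ⊆ ℝ^d`. -/
def GoodK2 {d : ℕ} (φ₂ : Esp d → ℝ) : Prop :=
  ContDiff ℝ (⊤ : ℕ∞) φ₂ ∧ HasCompactSupport φ₂ ∧ tsupport φ₂ ⊆ Metric.ball (0 : Esp d) (1/2) ∧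
    (∀ z, 0 ≤ φ₂ z) ∧ (∫ z : Esp d, φ₂ z) = 1

/-- `Ω_T = Ω × (0,T)`. -/
def timeSpace {d : ℕ} (Ω : Set (Esp d)) (T : ℝ) : Set (Esp d × ℝ) := Ω ×ˢ Ioo 0 T

/-- The boundary layer `Ω_T^{k,ε}`. -/
def blayer {d : ℕ} (Ω : Set (Esp d)) (T k ε : ℝ) : Set (Esp d × ℝ) :=
  ({x ∈ Ω | Metric.infDist x Ωᶜ < k * ε} ×ˢ Ioo 0 T) ∪ (Ω ×ˢ Ioo 0 (k * ε ^ 2)) ∪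
    (Ω ×ˢ Ioo (T - k * ε ^ 2) T)

/-- Weak (distributional) gradient of `u` on an open set `U ⊆ ℝ^d`. -/
def IsWeakGradOn {d : ℕ} (U : Set (Esp d)) (u : Esp d → ℝ) (v : Esp d → Esp d) : Prop :=
  ∀ φ : Esp d → ℝ, ContDiff ℝ (⊤ : ℕ∞) φ → HasCompactSupport φ → tsupport φ ⊆ U →
    ∀ i, ∫ x in U, u x * fderiv ℝ φ x (EuclideanSpace.single i 1) =
      - ∫ x in U, v x i * φ x

/-- The fractional Sobolev–Slobodeckij seminorm `[·]_{W^{σ,q}}` with `σ = 1/2`, built from a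
given family of norms `N t₁ t₂ = ‖h(t₁) − h(t₂)‖_X`; junk value `∞` for `q = ∞`. -/
def fracSemi (q : ℝ≥0∞) (I : Set ℝ) (N : ℝ → ℝ → ℝ≥0∞) : ℝ≥0∞ :=
  if q = ∞ then ∞ else
    (∫⁻ t₁ in I, ∫⁻ t₂ in I,
        N t₁ t₂ ^ q.toReal / ENNReal.ofReal (|t₁ - t₂| ^ (1 + q.toReal / 2))) ^ (1 / q.toReal)

/-- The seminorm `[g]_{𝓗(Ω_T; L^∞)}`, computed with a given weak `x`-gradient `G` of `g`. -/
def HSemi {d : ℕ} (Ω : Set (Esp d)) (T : ℝ) (g : Esp d → ℝ → Esp d → ℝ → ℝ)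
    (G : Esp d → ℝ → Esp d → ℝ → Esp d) : ℝ≥0∞ :=
  fracSemi 2 (Ioo 0 T)
      (fun t₁ t₂ => eLp ⊤ (volume.restrict Ω)
        (fun x => cellNorm ⊤ ⊤ (fun y τ => g x t₁ y τ - g x t₂ y τ))) +
    mixNorm ⊤ (d : ℝ≥0∞) (timeSpace Ω T)
      (fun x t => cellNorm ⊤ ⊤ (fun y τ => ‖G x t y τ‖))

section eLpToolkit

variable {α β : Type*} [MeasurableSpace α] [MeasurableSpace β]

lemma measurable_essSup_right {μ : Measure β} [SFinite μ] {f : α → β → ℝ≥0∞}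
    (hf : Measurable (Function.uncurry f)) : Measurable fun a => essSup (f a) μ := by
  refine measurable_of_Iic fun c => ?_
  have hset : (fun a => essSup (f a) μ) ⁻¹' Iic c =
      {a | μ (Prod.mk a ⁻¹' (Function.uncurry f ⁻¹' Ioi c)) = 0} := by
    ext a
    simp only [mem_preimage, mem_Iic, mem_ofPred_eq]
    constructor
    · intro h
      have := ENNReal.ae_le_essSup (μ := μ) (f a)
      rw [ae_iff] at this
      refine measure_mono_null ?_ this
      intro y hy
      simp only [mem_preimage, mem_Ioi, Function.uncurry_apply_pair] at hy
      simpa using h.trans_lt hy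
    · intro h
      refine essSup_le_of_ae_le c ?_
      rw [Filter.EventuallyLE, ae_iff]
      refine measure_mono_null ?_ h
      intro y hy
      simpa using hy
  rw [hset]
  exact (measurable_measure_prodMk_left (hf measurableSet_Ioi)) (measurableSet_singleton 0)

lemma measurable_eLp_right {μ : Measure β} [SFinite μ] {p : ℝ≥0∞} {f : α → β → ℝ≥0∞}
    (hf : Measurable (Function.uncurry f)) : Measurable fun a => eLp p μ (f a) := by
  unfold eLp
  split_ifs
  · exact measurable_essSup_right hf
  · exact (Measurable.lintegral_prod_right' (hf.pow_const _)).pow_const _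

lemma eLp_top (μ : Measure α) (f : α → ℝ≥0∞) : eLp ∞ μ f = essSup f μ := by simp [eLp]

lemma eLp_of_ne_top {p : ℝ≥0∞} (hp : p ≠ ∞) (μ : Measure α) (f : α → ℝ≥0∞) :
    eLp p μ f = (∫⁻ x, f x ^ p.toReal ∂μ) ^ (1 / p.toReal) := by simp [eLp, hp]

lemma eLp_one (μ : Measure α) (f : α → ℝ≥0∞) : eLp 1 μ f = ∫⁻ x, f x ∂μ := by simp [eLp]

lemma eLp_mono_ae {p : ℝ≥0∞} {μ : Measure α} {f g : α → ℝ≥0∞} (h : ∀ᵐ x ∂μ, f x ≤ g x) :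
    eLp p μ f ≤ eLp p μ g := by
  unfold eLp
  split_ifs
  · exact essSup_mono_ae h
  · gcongr ?_ ^ _
    refine lintegral_mono_ae (h.mono fun x hx => ?_)
    gcongr

lemma eLp_indicator {p : ℝ≥0∞} (hp : p ≠ 0) {μ : Measure α} {s : Set α} (hs : MeasurableSet s)
    (f : α → ℝ≥0∞) : eLp p μ (s.indicator f) = eLp p (μ.restrict s) f := by
  unfold eLp
  split_ifs with h
  · exact ENNReal.essSup_indicator_eq_essSup_restrict hs
  · rw [← lintegral_indicator hs]
    congr 2 with x
    by_cases hx : x ∈ s <;> simp [hx, ENNReal.toReal_pos hp h]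

lemma eLp_rpow_half {p : ℝ≥0∞} (μ : Measure α) (f : α → ℝ≥0∞) :
    eLp p μ (fun x => f x ^ (1 / 2 : ℝ)) = eLp (p / 2) μ f ^ (1 / 2 : ℝ) := by
  rcases eq_or_ne p ∞ with rfl | hp
  · rw [ENNReal.top_div_of_ne_top (by simp), eLp_top, eLp_top]
    exact ((ENNReal.orderIsoRpow (1 / 2) (by norm_num)).essSup_apply f μ).symm
  · have hp2 : p / 2 ≠ ∞ := ENNReal.div_ne_top hp (by simp)
    rw [eLp_of_ne_top hp, eLp_of_ne_top hp2]
    simp_rw [← ENNReal.rpow_mul, ENNReal.toReal_div]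
    congr 2
    · congr 1 with x
      congr 1
      simp only [ENNReal.toReal_ofNat]; ring
    · simp only [ENNReal.toReal_ofNat]
      rw [one_div_div]; ring

lemma eLp_half_sq {p : ℝ≥0∞} (μ : Measure α) (f : α → ℝ≥0∞) :
    eLp (p / 2) μ (fun x => f x ^ 2) ^ (1 / 2 : ℝ) = eLp p μ f := by
  rw [← eLp_rpow_half]
  congr 1 with x
  rw [← ENNReal.rpow_natCast, ← ENNReal.rpow_mul]
  norm_num

/-- Hölder's inequality for `eLp`. -/
lemma eLp_mul_le {a b r : ℝ≥0∞} (ha : a ≠ 0) (hb : b ≠ 0) (h : r⁻¹ = a⁻¹ + b⁻¹)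
    {μ : Measure α} {f g : α → ℝ≥0∞} (hf : AEMeasurable f μ) (hg : AEMeasurable g μ) :
    eLp r μ (fun x => f x * g x) ≤ eLp a μ f * eLp b μ g := by
  have key : ∀ {b : ℝ≥0∞}, b ≠ 0 → ∀ {f g : α → ℝ≥0∞}, AEMeasurable f μ → AEMeasurable g μ →
      eLp b μ (fun x => f x * g x) ≤ eLp ∞ μ f * eLp b μ g := by
    intro b hb f g hf hg
    rw [eLp_top]
    rcases eq_or_ne b ∞ with rfl | hb'
    · simp only [eLp_top]; exact ENNReal.essSup_mul_le f g
    have hr := ENNReal.toReal_pos hb hb'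
    calc eLp b μ (fun x => f x * g x) ≤ eLp b μ (fun x => essSup f μ * g x) :=
          eLp_mono_ae ((ENNReal.ae_le_essSup f).mono fun x hx => by gcongr)
      _ = essSup f μ * eLp b μ g := by
          rw [eLp_of_ne_top hb', eLp_of_ne_top hb']
          simp_rw [ENNReal.mul_rpow_of_nonneg _ _ hr.le]
          rw [lintegral_const_mul'' _ (hg.pow_const _), ENNReal.mul_rpow_of_nonneg _ _ (by positivity),
            ← ENNReal.rpow_mul, mul_one_div_cancel hr.ne', ENNReal.rpow_one]
  rcases eq_or_ne a ∞ with rfl | ha'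
  · have : r = b := by simpa using h
    subst this
    exact key hb hf hg
  rcases eq_or_ne b ∞ with rfl | hb'
  · have : r = a := by simpa using h
    subst this
    simpa only [mul_comm] using key ha hg hf
  have har := ENNReal.toReal_pos ha ha'
  have hbr := ENNReal.toReal_pos hb hb'
  have hr0 : r ≠ 0 := by
    rintro rfl
    simp only [ENNReal.inv_zero] at h
    exact ENNReal.add_ne_top.2 ⟨ENNReal.inv_ne_top.2 ha, ENNReal.inv_ne_top.2 hb⟩ h.symm
  have hrt : r ≠ ∞ := by
    rintro rfl
    rw [ENNReal.inv_top, eq_comm, add_eq_zero] at h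
    exact ha' (ENNReal.inv_eq_zero.1 h.1)
  have hrr := ENNReal.toReal_pos hr0 hrt
  have hinv : 1 / r.toReal = 1 / a.toReal + 1 / b.toReal := by
    have := congrArg ENNReal.toReal h
    rw [ENNReal.toReal_add (ENNReal.inv_ne_top.2 ha) (ENNReal.inv_ne_top.2 hb)] at this
    simpa [ENNReal.toReal_inv] using this
  have hlt : r.toReal < a.toReal := by
    have : 1 / a.toReal < 1 / r.toReal := by
      rw [hinv]; have := one_div_pos.2 hbr; linarith
    exact (one_div_lt_one_div har hrr).1 this
  rw [eLp_of_ne_top hrt, eLp_of_ne_top ha', eLp_of_ne_top hb']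
  exact ENNReal.lintegral_Lp_mul_le_Lq_mul_Lr hrr hlt hinv μ hf hg

/-- Minkowski's integral inequality, under the assumption that the left side is finite. -/
lemma lintegral_rpow_le_of_ne_top {μ : Measure α} {ν : Measure β} [SFinite μ] [SFinite ν]
    {r : ℝ} (hr : 1 < r) {a : α → β → ℝ≥0∞} (ha : Measurable (Function.uncurry a))
    (hfin : ∫⁻ x, (∫⁻ z, a x z ∂ν) ^ r ∂μ ≠ ∞) :
    (∫⁻ x, (∫⁻ z, a x z ∂ν) ^ r ∂μ) ^ (1 / r) ≤
      ∫⁻ z, (∫⁻ x, a x z ^ r ∂μ) ^ (1 / r) ∂ν := by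
  set A : α → ℝ≥0∞ := fun x => ∫⁻ z, a x z ∂ν with hA
  have hAm : Measurable A := ha.lintegral_prod_right'
  set I := ∫⁻ x, A x ^ r ∂μ with hI
  set M := ∫⁻ z, (∫⁻ x, a x z ^ r ∂μ) ^ (1 / r) ∂ν with hM
  have hr0 : 0 < r := by linarith
  rcases eq_or_ne I 0 with h0 | h0
  · rw [h0, ENNReal.zero_rpow_of_pos (by positivity)]; exact zero_le
  have hconj : r.HolderConjugate r.conjExponent := Real.HolderConjugate.conjExponent hr
  have h1 : I = ∫⁻ z, ∫⁻ x, a x z * A x ^ (r - 1) ∂μ ∂ν := by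
    rw [lintegral_lintegral_swap]
    · refine lintegral_congr fun x => ?_
      rw [show ∫⁻ z, a x z * A x ^ (r - 1) ∂ν = A x * A x ^ (r - 1) from
        lintegral_mul_const _ (ha.comp measurable_prodMk_left)]
      nth_rewrite 2 [← ENNReal.rpow_one (A x)]
      rw [← ENNReal.rpow_add_of_nonneg _ _ zero_le_one (by linarith)]
      congr 1; ring
    · refine Measurable.aemeasurable ?_
      exact (ha.comp measurable_swap).mul ((hAm.comp measurable_snd).pow_const _)
  have h2 : I ≤ M * I ^ (1 / r.conjExponent) := by
    calc I = ∫⁻ z, ∫⁻ x, a x z * A x ^ (r - 1) ∂μ ∂ν := h1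
      _ ≤ ∫⁻ z, (∫⁻ x, a x z ^ r ∂μ) ^ (1 / r) * I ^ (1 / r.conjExponent) ∂ν := by
          refine lintegral_mono fun z => ?_
          exact ENNReal.lintegral_mul_rpow_le_lintegral_rpow_mul_lintegral_rpow hconj
            (ha.comp measurable_prodMk_right).aemeasurable hAm.aemeasurable
      _ = M * I ^ (1 / r.conjExponent) := by
          rw [lintegral_mul_const]
          exact ((Measurable.lintegral_prod_left'
            (f := fun w : α × β => a w.1 w.2 ^ r) (ha.pow_const r))).pow_const _
  have h3 : I = I ^ (1 / r) * I ^ (1 / r.conjExponent) := by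
    rw [← ENNReal.rpow_add _ _ h0 hfin]
    have := hconj.inv_add_inv_eq_one
    simp only [one_div, this, ENNReal.rpow_one]
  have h4 : I ^ (1 / r.conjExponent) ≠ 0 := by
    simp [ENNReal.rpow_eq_zero_iff, h0, hfin]
  have h5 : I ^ (1 / r.conjExponent) ≠ ∞ :=
    ENNReal.rpow_ne_top_of_nonneg (by have := hconj.symm.pos; positivity) hfin
  nth_rewrite 1 [h3] at h2
  exact (ENNReal.mul_le_mul_iff_left h4 h5).1 h2

/-- Minkowski's integral inequality for a finite outer measure. -/
lemma eLp_lintegral_le {μ : Measure α} {ν : Measure β} [SigmaFinite μ] [IsFiniteMeasure ν]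
    {r : ℝ≥0∞} (hr : 1 ≤ r) {a : α → β → ℝ≥0∞} (ha : Measurable (Function.uncurry a)) :
    eLp r μ (fun x => ∫⁻ z, a x z ∂ν) ≤ ∫⁻ z, eLp r μ (fun x => a x z) ∂ν := by
  have hsw : Measurable (Function.uncurry fun z x => a x z) := ha.comp measurable_swap
  rcases eq_or_ne r ∞ with rfl | hrt
  · simp only [eLp_top]
    refine essSup_le_of_ae_le _ ?_
    have hm : Measurable fun z => essSup (fun x => a x z) μ := measurable_essSup_right hsw
    have h1 : ∀ᵐ z ∂ν, ∀ᵐ x ∂μ, a x z ≤ essSup (fun x => a x z) μ :=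
      Filter.Eventually.of_forall fun z => ENNReal.ae_le_essSup _
    rw [Measure.ae_ae_comm] at h1
    · exact h1.mono fun x hx => lintegral_mono_ae hx
    · exact measurableSet_le hsw (hm.comp measurable_fst)
  rcases hr.eq_or_lt with rfl | hr1
  · simp only [eLp_one]
    rw [lintegral_lintegral_swap ha.aemeasurable]
  have hrr : 1 < r.toReal := by
    rw [← ENNReal.toReal_one]
    exact (ENNReal.toReal_lt_toReal (by simp) hrt).2 hr1
  simp only [eLp_of_ne_top hrt]
  set t := r.toReal
  let S := spanningSets μ
  let b : ℕ → α → β → ℝ≥0∞ := fun n x z => (S n).indicator (fun x => min (a x z) n) x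
  have hb : ∀ n, Measurable (Function.uncurry (b n)) := fun n => by
    have : Function.uncurry (b n) =
        (S n ×ˢ univ).indicator (fun w : α × β => min (a w.1 w.2) n) := by
      ext ⟨x, z⟩
      by_cases hx : x ∈ S n <;> simp [b, hx]
    rw [this]
    exact (ha.min measurable_const).indicator ((measurableSet_spanningSets μ n).prod .univ)
  have hbmono : ∀ x z, Monotone fun n => b n x z := by
    intro x z m n hmn
    simp only [b]
    by_cases hx : x ∈ S m
    · have hx' : x ∈ S n := monotone_spanningSets μ hmn hx
      simp only [hx, hx', indicator_of_mem]
      gcongr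
    · simp [hx]
  have hble : ∀ n x z, b n x z ≤ a x z := by
    intro n x z
    by_cases hx : x ∈ S n <;> simp [b, hx]
  have hblim : ∀ x z, Filter.Tendsto (fun n => b n x z) Filter.atTop (nhds (a x z)) := by
    intro x z
    have h1 : Filter.Tendsto (fun n : ℕ => min (a x z) (n : ℝ≥0∞)) Filter.atTop
        (nhds (min (a x z) ∞)) := tendsto_const_nhds.min ENNReal.tendsto_nat_nhds_top
    rw [min_eq_left le_top] at h1
    refine h1.congr' ?_
    obtain ⟨N, hN⟩ := mem_iUnion.1 ((iUnion_spanningSets μ).symm ▸ mem_univ x)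
    filter_upwards [Filter.eventually_ge_atTop N] with n hn
    have : x ∈ S n := monotone_spanningSets μ hn hN
    simp [b, this]
  have hfin : ∀ n, ∫⁻ x, (∫⁻ z, b n x z ∂ν) ^ t ∂μ ≠ ∞ := by
    intro n
    have : ∀ x, (∫⁻ z, b n x z ∂ν) ^ t ≤ (S n).indicator (fun _ => ((n : ℝ≥0∞) * ν univ) ^ t) x := by
      intro x
      by_cases hx : x ∈ S n
      · simp only [hx, indicator_of_mem]
        gcongr
        calc ∫⁻ z, b n x z ∂ν ≤ ∫⁻ _, (n : ℝ≥0∞) ∂ν :=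
              lintegral_mono fun z => by simp [b, hx]
          _ = _ := by simp
      · simp [b, hx, show 0 < t by linarith]
    refine ne_top_of_le_ne_top ?_ (lintegral_mono this)
    rw [lintegral_indicator (measurableSet_spanningSets μ n), setLIntegral_const]
    refine ENNReal.mul_ne_top (ENNReal.rpow_ne_top_of_nonneg (by linarith) ?_)
      (measure_spanningSets_lt_top μ n).ne
    exact ENNReal.mul_ne_top (by simp) (measure_ne_top _ _)
  have hle : ∀ n, (∫⁻ x, (∫⁻ z, b n x z ∂ν) ^ t ∂μ) ^ (1 / t) ≤
      ∫⁻ z, (∫⁻ x, a x z ^ t ∂μ) ^ (1 / t) ∂ν := by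
    intro n
    refine (lintegral_rpow_le_of_ne_top hrr (hb n) (hfin n)).trans ?_
    gcongr with z x
    exact hble n x z
  have hA : ∀ x, Filter.Tendsto (fun n => ∫⁻ z, b n x z ∂ν) Filter.atTop
      (nhds (∫⁻ z, a x z ∂ν)) := fun x =>
    lintegral_tendsto_of_tendsto_of_monotone
      (fun n => ((hb n).comp measurable_prodMk_left).aemeasurable)
      (Filter.Eventually.of_forall fun z => hbmono x z) (Filter.Eventually.of_forall fun z => hblim x z)
  have hlim : Filter.Tendsto (fun n => ∫⁻ x, (∫⁻ z, b n x z ∂ν) ^ t ∂μ) Filter.atTop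
      (nhds (∫⁻ x, (∫⁻ z, a x z ∂ν) ^ t ∂μ)) := by
    refine lintegral_tendsto_of_tendsto_of_monotone
      (fun n => ((hb n).lintegral_prod_right'.pow_const _).aemeasurable)
      (Filter.Eventually.of_forall fun x m n hmn => ?_) (Filter.Eventually.of_forall fun x => ?_)
    · dsimp only
      gcongr with z
      exact hbmono x z hmn
    · exact ((ENNReal.continuous_rpow_const).tendsto _).comp (hA x)
  exact le_of_tendsto (((ENNReal.continuous_rpow_const).tendsto _).comp hlim)
    (Filter.Eventually.of_forall hle)

end eLpToolkit

section Periodicity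

open scoped Pointwise in
lemma isAddFundamentalDomain_ball_subset {d : ℕ} (c : Esp d) :
    ∃ s : Set (Esp d), Metric.ball c (1 / 2) ⊆ s ∧
      IsAddFundamentalDomain
        (Submodule.span ℤ
          (Set.range (EuclideanSpace.basisFun (Fin d) ℝ).toBasis)).toAddSubgroup s volume := by
  set b := (EuclideanSpace.basisFun (Fin d) ℝ).toBasis
  set a : Esp d := c - WithLp.toLp 2 (fun _ => (1 / 2 : ℝ))
  refine ⟨a +ᵥ ZSpan.fundamentalDomain b, ?_, ?_⟩
  · intro y hy
    refine ⟨y - a, ?_, by simp [vadd_eq_add]⟩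
    rw [ZSpan.mem_fundamentalDomain]
    intro i
    have h1 : |y i - c i| < 1 / 2 := by
      have := PiLp.norm_apply_le (y - c) i
      rw [Metric.mem_ball, dist_eq_norm] at hy
      simpa using this.trans_lt hy
    have h2 : b.repr (y - a) i = y i - c i + 1 / 2 := by
      simp [b, a]; ring
    rw [h2, abs_lt] at *
    constructor <;> linarith [h1.1, h1.2]
  · exact (ZSpan.isAddFundamentalDomain' b volume).vadd_of_comm a

lemma fundamentalDomain_subset_unitCell (d : ℕ) :
    ZSpan.fundamentalDomain (EuclideanSpace.basisFun (Fin d) ℝ).toBasis ⊆ unitCell d := by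
  intro y hy i
  have := (ZSpan.mem_fundamentalDomain _).1 hy i
  simp only [OrthonormalBasis.coe_toBasis_repr_apply, EuclideanSpace.basisFun_repr] at this
  exact ⟨this.1, this.2.le⟩

lemma periodic_vadd_eq {d : ℕ} {β : Type*} {u : Esp d → β}
    (hu : ∀ y i, u (y + EuclideanSpace.single i 1) = u y)
    (v : (Submodule.span ℤ
      (Set.range (EuclideanSpace.basisFun (Fin d) ℝ).toBasis)).toAddSubgroup) (y : Esp d) :
    u (v +ᵥ y) = u y := by
  obtain ⟨v, hv⟩ := v
  change u (v + y) = u y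
  rw [Submodule.mem_toAddSubgroup] at hv
  induction hv using Submodule.span_induction generalizing y with
  | mem x hx =>
    obtain ⟨i, rfl⟩ := hx
    rw [add_comm]
    simpa using hu y i
  | zero => simp
  | add x z _ _ hx hz => rw [add_assoc, hx, hz]
  | smul n x _ hx =>
    induction n using Int.induction_on generalizing y with
    | zero => simp
    | succ k ih => rw [add_smul, one_smul, add_assoc, ih, hx]
    | pred k ih =>
      have := hx (y := (-(k : ℤ) - 1) • x + y)
      rw [← this, ← ih y]
      congr 1
      rw [sub_smul, one_smul]; abel

instance countable_span_basisFun (d : ℕ) : Countable (Submodule.span ℤ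
    (Set.range (EuclideanSpace.basisFun (Fin d) ℝ).toBasis)).toAddSubgroup :=
  inferInstanceAs (Countable (Submodule.span ℤ
    (Set.range (EuclideanSpace.basisFun (Fin d) ℝ).toBasis)))

lemma lintegral_ball_le_unitCell {d : ℕ} {u : Esp d → ℝ≥0∞}
    (hu : ∀ y i, u (y + EuclideanSpace.single i 1) = u y) (c : Esp d) :
    ∫⁻ y in Metric.ball c (1 / 2), u y ≤ ∫⁻ y in unitCell d, u y := by
  obtain ⟨s, hs, hfs⟩ := isAddFundamentalDomain_ball_subset c
  calc ∫⁻ y in Metric.ball c (1 / 2), u y ≤ ∫⁻ y in s, u y := lintegral_mono_set hs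
    _ = ∫⁻ y in ZSpan.fundamentalDomain (EuclideanSpace.basisFun (Fin d) ℝ).toBasis, u y :=
        hfs.setLIntegral_eq (ZSpan.isAddFundamentalDomain' _ volume) u
          fun g x => periodic_vadd_eq hu g x
    _ ≤ _ := lintegral_mono_set (fundamentalDomain_subset_unitCell d)

lemma ae_of_ae_unitCell {d : ℕ} {P : Esp d → Prop}
    (hP : ∀ y i, P (y + EuclideanSpace.single i 1) ↔ P y)
    (h : ∀ᵐ y ∂volume.restrict (unitCell d), P y) : ∀ᵐ y : Esp d, P y := by
  have hP' : ∀ y i, P (y + EuclideanSpace.single i 1) = P y := fun y i => propext (hP y i)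
  refine (ZSpan.isAddFundamentalDomain' (EuclideanSpace.basisFun (Fin d) ℝ).toBasis
    volume).measure_zero_of_invariant {y | ¬ P y} (fun g => ?_) ?_
  · ext y
    rw [Set.mem_vadd_set_iff_neg_vadd_mem]
    simp only [mem_ofPred_eq, periodic_vadd_eq hP']
  · have h2 := ae_restrict_of_ae_restrict_of_subset (fundamentalDomain_subset_unitCell d) h
    rw [ae_iff, Measure.restrict_apply₀'] at h2
    · exact h2
    · exact (ZSpan.fundamentalDomain_measurableSet _).nullMeasurableSet

lemma periodic_zmultiples_vadd_eq {β : Type*} {u : ℝ → β} (hu : ∀ y, u (y + 1) = u y)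
    (v : AddSubgroup.zmultiples (1 : ℝ)) (y : ℝ) : u (v +ᵥ y) = u y := by
  obtain ⟨_, n, rfl⟩ := v
  change u (n • (1 : ℝ) + y) = u y
  rw [add_comm]
  exact (show Function.Periodic u 1 from hu).zsmul n y

lemma lintegral_ball_le_Ioc {u : ℝ → ℝ≥0∞} (hu : ∀ y, u (y + 1) = u y) (c : ℝ) :
    ∫⁻ y in Metric.ball c (1 / 2), u y ≤ ∫⁻ y in Ioc 0 1, u y := by
  have h1 := isAddFundamentalDomain_Ioc (T := 1) one_pos (c - 1 / 2) volume
  have h2 := isAddFundamentalDomain_Ioc (T := 1) one_pos 0 volume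
  rw [zero_add] at h2
  calc ∫⁻ y in Metric.ball c (1 / 2), u y ≤ ∫⁻ y in Ioc (c - 1 / 2) (c - 1 / 2 + 1), u y := by
        refine lintegral_mono_set fun y hy => ?_
        rw [Real.ball_eq_Ioo] at hy
        exact ⟨hy.1, by linarith [hy.2]⟩
    _ = _ := h1.setLIntegral_eq h2 u fun g x => periodic_zmultiples_vadd_eq hu g x

lemma ae_of_ae_Ioc {P : ℝ → Prop} (hP : ∀ y, P (y + 1) ↔ P y)
    (h : ∀ᵐ y ∂volume.restrict (Ioc (0 : ℝ) 1), P y) : ∀ᵐ y, P y := by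
  have hP' : ∀ y, P (y + 1) = P y := fun y => propext (hP y)
  have h2 := isAddFundamentalDomain_Ioc (T := 1) one_pos 0 volume
  rw [zero_add] at h2
  refine h2.measure_zero_of_invariant {y | ¬ P y} (fun g => ?_) ?_
  · ext y
    rw [Set.mem_vadd_set_iff_neg_vadd_mem]
    simp only [mem_ofPred_eq, periodic_zmultiples_vadd_eq hP']
  · rwa [ae_iff, Measure.restrict_apply₀' measurableSet_Ioc.nullMeasurableSet] at h

lemma ae_ae_of_ae_cell {d : ℕ} {P : Esp d → ℝ → Prop}
    (hP : ∀ y τ, (∀ i, P (y + EuclideanSpace.single i 1) τ ↔ P y τ) ∧ (P y (τ + 1) ↔ P y τ))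
    (h : ∀ᵐ τ ∂volume.restrict (Ioc (0 : ℝ) 1), ∀ᵐ y ∂volume.restrict (unitCell d), P y τ) :
    ∀ᵐ τ : ℝ, ∀ᵐ y : Esp d, P y τ := by
  refine ae_of_ae_Ioc (fun τ => ?_) (h.mono fun τ hτ => ae_of_ae_unitCell (fun y i => (hP y τ).1 i) hτ)
  simp only [(hP _ τ).2]

/-- A property of the microscopic variables valid almost everywhere is valid along
`(x, t) ↦ (x / ε, t / ε²)`. -/
lemma ae_ae_osc {d : ℕ} {ε : ℝ} (hε : 0 < ε) {P : Esp d → ℝ → Prop}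
    (h : ∀ᵐ τ : ℝ, ∀ᵐ y : Esp d, P y τ) :
    ∀ᵐ t : ℝ, ∀ᵐ x : Esp d, P (ε⁻¹ • x) (t / ε ^ 2) := by
  have h1 := (Measure.quasiMeasurePreserving_smul (E := ℝ) volume
    (r := (ε ^ 2)⁻¹) (by positivity)).ae h
  refine h1.mono fun t ht => ?_
  have h2 := (Measure.quasiMeasurePreserving_smul (E := Esp d) volume
    (r := ε⁻¹) (by positivity)).ae ht
  refine h2.mono fun x hx => ?_
  rwa [smul_eq_mul, inv_mul_eq_div] at hx

end Periodicity

section Kernels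

/-- The space kernel `φ_{2,ε}` with values in `ℝ≥0∞`. -/
def kerX {d : ℕ} (φ : Esp d → ℝ) (ε : ℝ) (z : Esp d) : ℝ≥0∞ :=
  ENNReal.ofReal ((ε ^ d)⁻¹ * φ (ε⁻¹ • z))

/-- The time kernel `φ_{1,ε}` with values in `ℝ≥0∞`. -/
def kerT (φ : ℝ → ℝ) (ε : ℝ) (s : ℝ) : ℝ≥0∞ :=
  ENNReal.ofReal ((ε ^ 2)⁻¹ * φ (s / ε ^ 2))

lemma lintegral_dilated_kernel {E : Type*} [NormedAddCommGroup E] [NormedSpace ℝ E]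
    [FiniteDimensional ℝ E] [MeasurableSpace E] [BorelSpace E] (μ : Measure E)
    [μ.IsAddHaarMeasure] {φ : E → ℝ} (hφ : Measurable φ) {r : ℝ} (hr : 0 < r) {u : E → ℝ≥0∞}
    (hu : Measurable u) (c : E) :
    ∫⁻ x, ENNReal.ofReal ((r ^ Module.finrank ℝ E)⁻¹ * φ (r⁻¹ • (x - c))) * u (r⁻¹ • x) ∂μ =
      ∫⁻ y, ENNReal.ofReal (φ (y - r⁻¹ • c)) * u y ∂μ := by
  have hm : Measurable fun y => ENNReal.ofReal (φ (y - r⁻¹ • c)) * u y := by fun_prop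
  have h1 := lintegral_map (μ := μ) hm (measurable_const_smul (r⁻¹))
  rw [Measure.map_addHaar_smul μ (inv_ne_zero hr.ne'), lintegral_smul_measure] at h1
  have h2 : ∀ x, ENNReal.ofReal ((r ^ Module.finrank ℝ E)⁻¹ * φ (r⁻¹ • (x - c))) * u (r⁻¹ • x) =
      ENNReal.ofReal ((r ^ Module.finrank ℝ E)⁻¹) *
        (ENNReal.ofReal (φ (r⁻¹ • x - r⁻¹ • c)) * u (r⁻¹ • x)) := fun x => by
    rw [ENNReal.ofReal_mul (by positivity), mul_assoc, smul_sub]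
  simp_rw [h2]
  rw [lintegral_const_mul _ (by fun_prop), ← h1, smul_eq_mul, ← mul_assoc, ← ENNReal.ofReal_mul
    (by positivity), abs_of_pos (by positivity), inv_pow, inv_inv, inv_mul_cancel₀ (by positivity)]
  simp

variable {d : ℕ} {φ₁ : ℝ → ℝ} {φ₂ : Esp d → ℝ} {ε : ℝ}

lemma measurable_kerX (h : GoodK2 φ₂) : Measurable (kerX φ₂ ε) := by
  have := h.1.continuous.measurable
  unfold kerX; fun_prop

lemma measurable_kerT (h : GoodK1 φ₁) : Measurable (kerT φ₁ ε) := by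
  have := h.1.continuous.measurable
  unfold kerT; fun_prop

lemma lintegral_kerX_mul (h : GoodK2 φ₂) (hε : 0 < ε) {u : Esp d → ℝ≥0∞} (hu : Measurable u)
    (c : Esp d) : ∫⁻ x, kerX φ₂ ε (x - c) * u (ε⁻¹ • x) =
      ∫⁻ y, ENNReal.ofReal (φ₂ (y - ε⁻¹ • c)) * u y := by
  have := lintegral_dilated_kernel volume h.1.continuous.measurable hε hu c
  rwa [finrank_euclideanSpace_fin] at this

lemma lintegral_kerT_mul (h : GoodK1 φ₁) (hε : 0 < ε) {u : ℝ → ℝ≥0∞} (hu : Measurable u)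
    (c : ℝ) : ∫⁻ x, kerT φ₁ ε (x - c) * u (x / ε ^ 2) =
      ∫⁻ y, ENNReal.ofReal (φ₁ (y - c / ε ^ 2)) * u y := by
  have := lintegral_dilated_kernel volume h.1.continuous.measurable
    (show 0 < ε ^ 2 by positivity) hu c
  simp_rw [Module.finrank_self, pow_one, smul_eq_mul, ← div_eq_inv_mul (_ : ℝ) (ε ^ 2)] at this
  rw [← this]
  simp_rw [kerT, inv_mul_eq_div]

lemma lintegral_kerX (h : GoodK2 φ₂) (hε : 0 < ε) : ∫⁻ x, kerX φ₂ ε x = 1 := by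
  have := lintegral_kerX_mul h hε (u := fun _ => 1) measurable_const 0
  simp only [sub_zero, mul_one, smul_zero] at this
  rw [this, ← ofReal_integral_eq_lintegral_ofReal
    (h.1.continuous.integrable_of_hasCompactSupport h.2.1)
    (Filter.Eventually.of_forall h.2.2.2.1), h.2.2.2.2, ENNReal.ofReal_one]

lemma lintegral_kerT (h : GoodK1 φ₁) (hε : 0 < ε) : ∫⁻ x, kerT φ₁ ε x = 1 := by
  have := lintegral_kerT_mul h hε (u := fun _ => 1) measurable_const 0
  simp only [sub_zero, mul_one, zero_div] at this
  rw [this, ← ofReal_integral_eq_lintegral_ofReal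
    (h.1.continuous.integrable_of_hasCompactSupport h.2.1)
    (Filter.Eventually.of_forall h.2.2.2.1), h.2.2.2.2, ENNReal.ofReal_one]

lemma norm_lt_of_kerX_ne_zero (h : GoodK2 φ₂) (hε : 0 < ε) {z : Esp d} (hz : kerX φ₂ ε z ≠ 0) :
    ‖z‖ < ε / 2 := by
  have h1 : φ₂ (ε⁻¹ • z) ≠ 0 := fun h0 => hz (by simp [kerX, h0])
  have h2 := h.2.2.1 (subset_tsupport _ h1)
  rw [mem_ball_zero_iff, norm_smul, norm_inv, Real.norm_of_nonneg hε.le, inv_mul_lt_iff₀ hε] at h2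
  linarith

lemma abs_lt_of_kerT_ne_zero (h : GoodK1 φ₁) (hε : 0 < ε) {s : ℝ} (hz : kerT φ₁ ε s ≠ 0) :
    |s| < ε ^ 2 / 2 := by
  have h1 : φ₁ (s / ε ^ 2) ≠ 0 := fun h0 => hz (by simp [kerT, h0])
  have h2 := h.2.2.1 (subset_tsupport _ h1)
  have hε2 : 0 < ε ^ 2 := by positivity
  rw [mem_Ioo, lt_div_iff₀ hε2, div_lt_iff₀ hε2] at h2
  rw [abs_lt]
  constructor <;> linarith [h2.1, h2.2]

lemma lintegral_kerX_periodic_le (h : GoodK2 φ₂) (hε : 0 < ε) {M : ℝ} (hM : ∀ y, φ₂ y ≤ M)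
    {u : Esp d → ℝ≥0∞} (hu : Measurable u) (hper : ∀ y i, u (y + EuclideanSpace.single i 1) = u y)
    (c : Esp d) :
    ∫⁻ x, kerX φ₂ ε (x - c) * u (ε⁻¹ • x) ≤ ENNReal.ofReal M * ∫⁻ y in unitCell d, u y := by
  rw [lintegral_kerX_mul h hε hu]
  refine le_trans ?_ (mul_le_mul_right (lintegral_ball_le_unitCell hper (ε⁻¹ • c)) _)
  rw [← lintegral_const_mul _ hu, ← lintegral_indicator Metric.isOpen_ball.measurableSet]
  refine lintegral_mono fun y => ?_
  by_cases hy : y ∈ Metric.ball (ε⁻¹ • c) (1 / 2)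
  · rw [indicator_of_mem hy]
    gcongr
    exact hM _
  · have : φ₂ (y - ε⁻¹ • c) = 0 := by
      by_contra h1
      have h2 := h.2.2.1 (subset_tsupport _ h1)
      rw [mem_ball_zero_iff] at h2
      exact hy (by rwa [Metric.mem_ball, dist_eq_norm])
    simp [this]

lemma lintegral_kerT_periodic_le (h : GoodK1 φ₁) (hε : 0 < ε) {M : ℝ} (hM : ∀ y, φ₁ y ≤ M)
    {u : ℝ → ℝ≥0∞} (hu : Measurable u) (hper : ∀ y, u (y + 1) = u y) (c : ℝ) :
    ∫⁻ x, kerT φ₁ ε (x - c) * u (x / ε ^ 2) ≤ ENNReal.ofReal M * ∫⁻ y in Ioc 0 1, u y := by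
  rw [lintegral_kerT_mul h hε hu]
  refine le_trans ?_ (mul_le_mul_right (lintegral_ball_le_Ioc hper (c / ε ^ 2)) _)
  rw [← lintegral_const_mul _ hu, ← lintegral_indicator Metric.isOpen_ball.measurableSet]
  refine lintegral_mono fun y => ?_
  by_cases hy : y ∈ Metric.ball (c / ε ^ 2) (1 / 2)
  · rw [indicator_of_mem hy]
    gcongr
    exact hM _
  · have : φ₁ (y - c / ε ^ 2) = 0 := by
      by_contra h1
      have h2 := h.2.2.1 (subset_tsupport _ h1)
      refine hy ?_
      rw [Real.ball_eq_Ioo]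
      constructor <;> linarith [h2.1, h2.2]
    simp [this]

end Kernels

section WeakGradient

open Metric

lemma integrable_shear {E F : Type*} [NormedAddCommGroup E] [NormedSpace ℝ E]
    [MeasurableSpace E] [BorelSpace E] [SecondCountableTopology E] [FiniteDimensional ℝ E]
    [NormedAddCommGroup F] {μ : Measure E} [μ.IsAddHaarMeasure] {w : E → F}
    (hm : StronglyMeasurable w) (hw : Integrable w μ) (z : E) (a b : ℝ) :
    Integrable (fun x : E × ℝ => w (x.1 + x.2 • z)) (μ.prod (volume.restrict (Ioc a b))) := by
  have hsm : StronglyMeasurable fun x : E × ℝ => w (x.1 + x.2 • z) :=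
    hm.comp_measurable (by fun_prop)
  refine ⟨hsm.aestronglyMeasurable, ?_⟩
  rw [HasFiniteIntegral, lintegral_prod_symm' _ hsm.enorm]
  simp only [lintegral_add_right_eq_self (fun x => ‖w x‖ₑ)]
  rw [lintegral_const]
  exact ENNReal.mul_lt_top hw.2 (measure_lt_top _ _)

variable {d : ℕ} {U : Set (Esp d)} {u : Esp d → ℝ} {v : Esp d → Esp d}

lemma IsWeakGradOn.integral_fderiv_apply (h : IsWeakGradOn U u v) {M : ℝ} (hu : Measurable u)
    (hM : ∀ x, |u x| ≤ M) (hv : IntegrableOn v U) {φ : Esp d → ℝ}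
    (hφ : ContDiff ℝ (⊤ : ℕ∞) φ) (hc : HasCompactSupport φ) (hs : tsupport φ ⊆ U) (z : Esp d) :
    ∫ x in U, u x * fderiv ℝ φ x z = -∫ x in U, inner ℝ (v x) z * φ x := by
  have hz : z = ∑ i, z i • EuclideanSpace.single i (1 : ℝ) := by
    ext j; simp [Pi.single_apply]
  obtain ⟨Mφ, hMφ⟩ := hc.exists_bound_of_continuous hφ.continuous
  have h1 : ∀ x, u x * fderiv ℝ φ x z =
      ∑ i, z i * (u x * fderiv ℝ φ x (EuclideanSpace.single i 1)) := fun x => by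
    conv_lhs => rw [hz]
    rw [map_sum, Finset.mul_sum]
    refine Finset.sum_congr rfl fun i _ => ?_
    rw [map_smul, smul_eq_mul]; ring
  have h2 : ∀ x, inner ℝ (v x) z * φ x = ∑ i, z i * (v x i * φ x) := fun x => by
    rw [PiLp.inner_apply, Finset.sum_mul]
    refine Finset.sum_congr rfl fun i _ => ?_
    simp; ring
  have hcont : ∀ i, Continuous fun x => fderiv ℝ φ x (EuclideanSpace.single i 1) := fun i =>
    (hφ.continuous_fderiv (by simp)).clm_apply continuous_const
  simp_rw [h1, h2]
  rw [integral_finsetSum, integral_finsetSum, ← Finset.sum_neg_distrib]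
  · refine Finset.sum_congr rfl fun i _ => ?_
    rw [integral_const_mul, integral_const_mul, h φ hφ hc hs i]; ring
  · intro i _
    refine Integrable.const_mul ?_ _
    exact ((ContinuousLinearMap.integrable_comp (EuclideanSpace.proj i : Esp d →L[ℝ] ℝ) hv)).mul_bdd
      (c := Mφ) hφ.continuous.aestronglyMeasurable (Filter.Eventually.of_forall hMφ)
  · intro i _
    refine Integrable.const_mul ?_ _
    refine (((hcont i).integrable_of_hasCompactSupport ?_).integrableOn).bdd_mul (c := M)
      hu.aestronglyMeasurable (Filter.Eventually.of_forall hM)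
    exact (hc.fderiv ℝ).comp_left (g := fun L : Esp d →L[ℝ] ℝ => L (EuclideanSpace.single i 1))
      (by simp)

lemma add_smul_mem_of_norm_lt_infDist {x z : Esp d} (hx : ‖z‖ < infDist x Uᶜ) {θ : ℝ}
    (hθ : |θ| ≤ 1) : x + θ • z ∈ U := by
  by_contra h
  have h1 := infDist_le_dist_of_mem (x := x) (show x + θ • z ∈ Uᶜ from h)
  rw [dist_self_add_right, norm_smul, Real.norm_eq_abs] at h1
  nlinarith [norm_nonneg z]

lemma IsWeakGradOn.integral_translate_sub (hU : MeasurableSet U) (h : IsWeakGradOn U u v) {M : ℝ}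
    (hu : Measurable u) (hM : ∀ x, |u x| ≤ M) (hvm : Measurable v) (hv : IntegrableOn v U)
    (z : Esp d) {φ : Esp d → ℝ} (hφ : ContDiff ℝ (⊤ : ℕ∞) φ) (hc : HasCompactSupport φ)
    (hs : tsupport φ ⊆ {x | ‖z‖ < infDist x Uᶜ}) :
    ∫ x, u x * (φ (x + z) - φ x) =
      -∫ x, φ x * ∫ θ in Ioc (0 : ℝ) 1, inner ℝ (U.indicator v (x + θ • -z)) z := by
  obtain ⟨Mφ, hMφ⟩ := hc.exists_bound_of_continuous hφ.continuous
  have hdc : Continuous fun x => fderiv ℝ φ x z :=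
    (hφ.continuous_fderiv (by simp)).clm_apply continuous_const
  have hdi : Integrable fun x => fderiv ℝ φ x z := hdc.integrable_of_hasCompactSupport
    ((hc.fderiv ℝ).comp_left (g := fun L : Esp d →L[ℝ] ℝ => L z) (by simp))
  have hftc : ∀ x, φ (x + z) - φ x = ∫ θ in Ioc (0 : ℝ) 1, fderiv ℝ φ (x + θ • z) z := fun x => by
    have hd : ∀ θ : ℝ, HasDerivAt (fun θ : ℝ => φ (x + θ • z)) (fderiv ℝ φ (x + θ • z) z) θ := by
      intro θ
      have h1 : HasDerivAt (fun θ : ℝ => x + θ • z) z θ := by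
        simpa using ((hasDerivAt_id θ).smul_const z).const_add x
      exact ((hφ.differentiable (by simp) _).hasFDerivAt).comp_hasDerivAt θ h1
    rw [← intervalIntegral.integral_of_le zero_le_one,
      intervalIntegral.integral_eq_sub_of_hasDerivAt (fun θ _ => hd θ)]
    · simp
    · exact (hdc.comp (by fun_prop)).intervalIntegrable _ _
  have hprod1 : Integrable (fun p : Esp d × ℝ => u p.1 * fderiv ℝ φ (p.1 + p.2 • z) z)
      (volume.prod (volume.restrict (Ioc 0 1))) :=
    (integrable_shear hdc.stronglyMeasurable hdi z 0 1).bdd_mul (c := M)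
      (hu.comp measurable_fst).aestronglyMeasurable (Filter.Eventually.of_forall fun p => hM p.1)
  have hvi : Integrable fun x => inner ℝ (U.indicator v x) z :=
    ((integrable_indicator_iff hU).2 hv).inner_const z
  have hvs : StronglyMeasurable fun x => inner ℝ (U.indicator v x) z :=
    ((hvm.indicator hU).inner measurable_const).stronglyMeasurable
  have hprod2 : Integrable
      (fun p : Esp d × ℝ => φ p.1 * inner ℝ (U.indicator v (p.1 + p.2 • -z)) z)
      (volume.prod (volume.restrict (Ioc 0 1))) :=
    (integrable_shear hvs hvi (-z) 0 1).bdd_mul (c := Mφ)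
      (hφ.continuous.measurable.comp measurable_fst).aestronglyMeasurable
      (Filter.Eventually.of_forall fun p => hMφ p.1)
  have hslice : ∀ θ ∈ Ioc (0 : ℝ) 1, ∫ x, u x * fderiv ℝ φ (x + θ • z) z =
      -∫ x, φ x * inner ℝ (U.indicator v (x + θ • -z)) z := by
    intro θ hθ
    have hts : tsupport (fun x => φ (x + θ • z)) ⊆ U := by
      intro x hx
      have h1 : x + θ • z ∈ tsupport φ :=
        tsupport_comp_subset_preimage φ (f := fun x => x + θ • z) (by fun_prop) hx
      have h2 := add_smul_mem_of_norm_lt_infDist (θ := -θ) (hs h1)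
        (by rw [abs_neg, abs_of_pos hθ.1]; exact hθ.2)
      rwa [add_assoc, ← add_smul, add_neg_cancel, zero_smul, add_zero] at h2
    have hcθ : HasCompactSupport fun x => φ (x + θ • z) :=
      hc.comp_homeomorph (Homeomorph.addRight (θ • z))
    have hz := h.integral_fderiv_apply hu hM hv
      (hφ.comp (contDiff_id.add contDiff_const)) hcθ hts z
    simp only [Function.comp_def, id] at hz
    simp_rw [fderiv_comp_add_right] at hz
    rw [setIntegral_eq_integral_of_forall_compl_eq_zero] at hz
    · rw [hz, ← integral_indicator hU,
        ← integral_add_right_eq_self (fun x => φ x * inner ℝ (U.indicator v (x + θ • -z)) z) (θ • z)]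
      congr 1
      refine integral_congr_ae (Filter.Eventually.of_forall fun x => ?_)
      simp only [add_assoc, smul_neg, add_neg_cancel, add_zero]
      by_cases hx : x ∈ U
      · simp [hx, mul_comm]
      · simp [hx]
    · intro x hx
      have h1 : x ∉ tsupport fun x => φ (x + θ • z) := fun h => hx (hts h)
      have h2 := fderiv_of_notMem_tsupport (𝕜 := ℝ) h1
      rw [fderiv_comp_add_right] at h2
      simp [h2]
  calc ∫ x, u x * (φ (x + z) - φ x)
      = ∫ x, ∫ θ in Ioc (0 : ℝ) 1, u x * fderiv ℝ φ (x + θ • z) z := by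
        simp_rw [hftc, integral_const_mul]
    _ = ∫ θ in Ioc (0 : ℝ) 1, ∫ x, u x * fderiv ℝ φ (x + θ • z) z := integral_integral_swap hprod1
    _ = ∫ θ in Ioc (0 : ℝ) 1, -∫ x, φ x * inner ℝ (U.indicator v (x + θ • -z)) z :=
        setIntegral_congr_fun measurableSet_Ioc hslice
    _ = -∫ x, ∫ θ in Ioc (0 : ℝ) 1, φ x * inner ℝ (U.indicator v (x + θ • -z)) z := by
        rw [integral_neg, ← integral_integral_swap hprod2]
    _ = _ := by simp_rw [integral_const_mul]

/-- A bounded function with an integrable weak gradient `v` on `U` has increments bounded by the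
integral of `|v|` along segments. -/
lemma IsWeakGradOn.ae_enorm_sub_le (hU : MeasurableSet U) (h : IsWeakGradOn U u v) {M : ℝ}
    (hu : Measurable u) (hM : ∀ x, |u x| ≤ M) (hvm : Measurable v) (hv : IntegrableOn v U)
    (z : Esp d) :
    ∀ᵐ x, ‖z‖ < infDist x Uᶜ → ‖u x - u (x - z)‖ₑ ≤
      ‖z‖ₑ * ∫⁻ θ in Ioc (0 : ℝ) 1, ‖U.indicator v (x - θ • z)‖ₑ := by
  set D : Esp d → ℝ := fun x => ∫ θ in Ioc (0 : ℝ) 1, inner ℝ (U.indicator v (x + θ • -z)) z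
    with hD
  have hvi : Integrable fun x => inner ℝ (U.indicator v x) z :=
    ((integrable_indicator_iff hU).2 hv).inner_const z
  have hvs : StronglyMeasurable fun x => inner ℝ (U.indicator v x) z :=
    ((hvm.indicator hU).inner measurable_const).stronglyMeasurable
  have hDi : Integrable D := (integrable_shear hvs hvi (-z) 0 1).integral_prod_left
  have hloc : ∀ w : Esp d → ℝ, Measurable w → (∀ x, |w x| ≤ M) → LocallyIntegrable w := by
    intro w hw hwM
    refine (locallyIntegrable_const M).mono hw.aestronglyMeasurable
      (Filter.Eventually.of_forall fun x => ?_)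
    exact (hwM x).trans (le_abs_self M)
  have hu2 : LocallyIntegrable fun x => u (x - z) :=
    hloc _ (hu.comp (measurable_id.sub_const z)) fun x => hM _
  have hu1 := hloc u hu hM
  have hopen : IsOpen {x : Esp d | ‖z‖ < infDist x Uᶜ} :=
    isOpen_lt continuous_const (continuous_infDist_pt _)
  have key : ∀ᵐ x, x ∈ {x : Esp d | ‖z‖ < infDist x Uᶜ} → u x - u (x - z) - D x = 0 := by
    refine hopen.ae_eq_zero_of_integral_contDiff_smul_eq_zero
      (((hu1.sub hu2).sub hDi.locallyIntegrable).locallyIntegrableOn _) ?_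
    intro φ hφ hc hs
    have hI : ∀ w : Esp d → ℝ, LocallyIntegrable w → Integrable fun x => φ x * w x :=
      fun w hw => hw.integrable_smul_left_of_hasCompactSupport hφ.continuous hc
    have h1 := h.integral_translate_sub hU hu hM hvm hv z hφ hc hs
    have h2 : ∫ x, φ x * u (x - z) = ∫ x, φ (x + z) * u x := by
      rw [← integral_add_right_eq_self (fun x => φ x * u (x - z)) z]
      simp
    have h3 : Integrable fun x => φ (x + z) * u x :=
      hu1.integrable_smul_left_of_hasCompactSupport (by have := hφ.continuous; fun_prop)
        (hc.comp_homeomorph (Homeomorph.addRight z))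
    have h4 : ∫ x, u x * (φ (x + z) - φ x) = (∫ x, φ (x + z) * u x) - ∫ x, φ x * u x := by
      rw [← integral_sub h3 (hI u hu1)]
      exact integral_congr_ae (Filter.Eventually.of_forall fun x => by simp only; ring)
    simp only [smul_eq_mul, mul_sub]
    have h5 : Integrable fun x => φ x * u x - φ x * u (x - z) := (hI _ hu1).sub (hI _ hu2)
    rw [integral_sub h5 (hI _ hDi.locallyIntegrable), integral_sub (hI _ hu1) (hI _ hu2), h2]
    linarith
  filter_upwards [key] with x hx hxz
  have h1 : u x - u (x - z) = D x := by linarith [hx hxz]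
  rw [h1, hD, ← lintegral_const_mul' _ _ enorm_ne_top]
  refine (enorm_integral_le_lintegral_enorm _).trans (lintegral_mono fun θ => ?_)
  rw [← ofReal_norm, ← ofReal_norm, ← ofReal_norm,
    ← ENNReal.ofReal_mul (norm_nonneg _)]
  refine ENNReal.ofReal_le_ofReal ((norm_inner_le_norm _ _).trans ?_)
  rw [mul_comm, smul_neg, ← sub_eq_add_neg]

end WeakGradient

section PointwiseBounds

section General

variable {α β : Type*} [MeasurableSpace α] [MeasurableSpace β]

lemma measurableSet_ae_right {ν : Measure β} [SFinite ν] {p : α → β → Prop}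
    (h : MeasurableSet {x : α × β | p x.1 x.2}) : MeasurableSet {a | ∀ᵐ b ∂ν, p a b} :=
  measurable_measure_prodMk_left h.compl (measurableSet_singleton 0)

lemma ae_prod_of_ae_ae_symm {μ : Measure α} {ν : Measure β} [SFinite μ] [SFinite ν]
    {p : α → β → Prop} (h : MeasurableSet {x : α × β | p x.1 x.2})
    (hp : ∀ᵐ b ∂ν, ∀ᵐ a ∂μ, p a b) : ∀ᵐ x ∂(μ.prod ν), p x.1 x.2 :=
  (Measure.ae_prod_iff_ae_ae h).2 ((Measure.ae_ae_comm h).2 hp)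

end General

variable {d : ℕ} {ε : ℝ}

lemma ae_osc (hε : 0 < ε) {R : Esp d → ℝ → Prop} (hm : MeasurableSet {x : Esp d × ℝ | R x.1 x.2})
    (h : ∀ᵐ τ : ℝ, ∀ᵐ y : Esp d, R y τ) :
    ∀ᵐ X : Esp d × ℝ, R (ε⁻¹ • X.1) (X.2 / ε ^ 2) := by
  have hmap : Measurable fun X : Esp d × ℝ => (ε⁻¹ • X.1, X.2 / ε ^ 2) := by fun_prop
  exact ae_prod_of_ae_ae_symm (p := fun x t => R (ε⁻¹ • x) (t / ε ^ 2)) (hmap hm) (ae_ae_osc hε h)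

lemma measurable_cellNorm {α : Type*} [MeasurableSpace α] {s r : ℝ≥0∞} {a : α → Esp d → ℝ → ℝ}
    (ha : Measurable fun p : α × Esp d × ℝ => a p.1 p.2.1 p.2.2) :
    Measurable fun x => cellNorm s r (a x) := by
  refine measurable_eLp_right (f := fun x τ => eLp r (volume.restrict (unitCell d))
    fun y => (‖a x y τ‖₊ : ℝ≥0∞)) ?_
  refine measurable_eLp_right (f := fun (p : α × ℝ) y => (‖a p.1 y p.2‖₊ : ℝ≥0∞)) ?_
  exact (ha.comp (f := fun p : (α × ℝ) × Esp d => (p.1.1, p.2, p.1.2)) (by fun_prop)).enorm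

lemma ae_ae_enorm_le_cellNorm_top (a : Esp d → ℝ → ℝ) :
    ∀ᵐ τ ∂volume.restrict (Ioc (0 : ℝ) 1), ∀ᵐ y ∂volume.restrict (unitCell d),
      ‖a y τ‖ₑ ≤ cellNorm ⊤ ⊤ a := by
  have h1 := ENNReal.ae_le_essSup (μ := volume.restrict (Ioc (0 : ℝ) 1))
    (fun τ => eLp ⊤ (volume.restrict (unitCell d)) fun y => (‖a y τ‖₊ : ℝ≥0∞))
  filter_upwards [h1] with τ hτ
  have h2 := ENNReal.ae_le_essSup (μ := volume.restrict (unitCell d))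
    (fun y => (‖a y τ‖₊ : ℝ≥0∞))
  filter_upwards [h2] with y hy
  rw [cellNorm, eLp_top]
  refine le_trans ?_ hτ
  rwa [eLp_top]

lemma ae_osc_enorm_le_cellNorm_top (hε : 0 < ε) {a : Esp d → ℝ → ℝ}
    (ha : Measurable fun p : Esp d × ℝ => a p.1 p.2)
    (hper : ∀ y τ, (∀ i, a (y + EuclideanSpace.single i 1) τ = a y τ) ∧ a y (τ + 1) = a y τ) :
    ∀ᵐ X : Esp d × ℝ, ‖a (ε⁻¹ • X.1) (X.2 / ε ^ 2)‖ₑ ≤ cellNorm ⊤ ⊤ a := by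
  refine ae_osc (R := fun y τ => ‖a y τ‖ₑ ≤ cellNorm ⊤ ⊤ a) hε
    (measurableSet_le ha.enorm measurable_const) ?_
  refine ae_ae_of_ae_cell (fun y τ => ⟨fun i => ?_, ?_⟩) (ae_ae_enorm_le_cellNorm_top a)
  · rw [(hper y τ).1]
  · rw [(hper y τ).2]

lemma measurable_setLIntegral_segment {α : Type*} [MeasurableSpace α] {W : α → Esp d → ℝ≥0∞}
    (hW : Measurable fun p : α × Esp d => W p.1 p.2) :
    Measurable fun p : α × Esp d × Esp d => ∫⁻ θ in Ioc (0 : ℝ) 1, W p.1 (p.2.1 - θ • p.2.2) :=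
  Measurable.lintegral_prod_right'
    (f := fun p : (α × Esp d × Esp d) × ℝ => W p.1.1 (p.1.2.1 - p.2 • p.1.2.2))
    (hW.comp (f := fun p : (α × Esp d × Esp d) × ℝ => (p.1.1, p.1.2.1 - p.2 • p.1.2.2))
      (by fun_prop))

/-- A time slice of `g`, evaluated along the oscillating variables, has increments controlled by
the cell supremum of its weak gradient. -/
lemma ae_ae_osc_enorm_sub_le (hε : 0 < ε) {Ω : Set (Esp d)} (hΩ : MeasurableSet Ω)
    {u : Esp d → Esp d → ℝ → ℝ} {v : Esp d → Esp d → ℝ → Esp d}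
    (hu : Measurable fun p : Esp d × Esp d × ℝ => u p.1 p.2.1 p.2.2)
    (hv : Measurable fun p : Esp d × Esp d × ℝ => v p.1 p.2.1 p.2.2)
    (hper : ∀ x y τ, (∀ i, u x (y + EuclideanSpace.single i 1) τ = u x y τ) ∧
      u x y (τ + 1) = u x y τ) {M : ℝ} (hM : ∀ x y τ, |u x y τ| ≤ M)
    (hw : ∀ᵐ τ : ℝ, ∀ᵐ y : Esp d, IsWeakGradOn Ω (fun x => u x y τ) (fun x => v x y τ))
    (hV : ∫⁻ x in Ω, cellNorm ⊤ ⊤ (fun y τ => ‖v x y τ‖) ≠ ∞) (z : Esp d) :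
    ∀ᵐ x, ∀ᵐ X : Esp d × ℝ, ‖z‖ < Metric.infDist x Ωᶜ →
      ‖u x (ε⁻¹ • X.1) (X.2 / ε ^ 2) - u (x - z) (ε⁻¹ • X.1) (X.2 / ε ^ 2)‖ₑ ≤
        ‖z‖ₑ * ∫⁻ θ in Ioc (0 : ℝ) 1,
          Ω.indicator (fun x => cellNorm ⊤ ⊤ (fun y τ => ‖v x y τ‖)) (x - θ • z) := by
  set V : Esp d → ℝ≥0∞ := fun x => cellNorm ⊤ ⊤ (fun y τ => ‖v x y τ‖) with hVdef
  have hVm : Measurable V := measurable_cellNorm (a := fun x y τ => ‖v x y τ‖) hv.norm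
  have hseg : Measurable fun x => ∫⁻ θ in Ioc (0 : ℝ) 1, Ω.indicator V (x - θ • z) :=
    (measurable_setLIntegral_segment (α := Unit) (W := fun _ => Ω.indicator V)
      ((hVm.indicator hΩ).comp measurable_snd)).comp
      (f := fun x => ((), x, z)) (by fun_prop)
  have hinf : Measurable fun x : Esp d => Metric.infDist x Ωᶜ := by fun_prop
  have hmeas : MeasurableSet {p : Esp d × Esp d × ℝ | ‖z‖ < Metric.infDist p.1 Ωᶜ →
      ‖u p.1 p.2.1 p.2.2 - u (p.1 - z) p.2.1 p.2.2‖ₑ ≤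
        ‖z‖ₑ * ∫⁻ θ in Ioc (0 : ℝ) 1, Ω.indicator V (p.1 - θ • z)} := by
    have h1 : Measurable fun p : Esp d × Esp d × ℝ => u (p.1 - z) p.2.1 p.2.2 :=
      hu.comp (f := fun p : Esp d × Esp d × ℝ => (p.1 - z, p.2.1, p.2.2)) (by fun_prop)
    have h2 := hseg.comp (measurable_fst : Measurable (Prod.fst : Esp d × Esp d × ℝ → Esp d))
    have h3 := hinf.comp (measurable_fst : Measurable (Prod.fst : Esp d × Esp d × ℝ → Esp d))
    exact (measurableSet_lt measurable_const h3).imp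
      (measurableSet_le (hu.sub h1).enorm (h2.const_mul _))
  have hbd : ∀ᵐ τ ∂volume.restrict (Ioc (0 : ℝ) 1), ∀ᵐ y ∂volume.restrict (unitCell d),
      ∀ᵐ x, ‖v x y τ‖ₑ ≤ V x := by
    have hm1 : MeasurableSet {p : (Esp d × ℝ) × Esp d | ‖v p.1.1 p.2 p.1.2‖ₑ ≤ V p.1.1} :=
      measurableSet_le
        (hv.comp (f := fun p : (Esp d × ℝ) × Esp d => (p.1.1, p.2, p.1.2)) (by fun_prop)).enorm
        (hVm.comp (by fun_prop))
    have hm2 : MeasurableSet {p : Esp d × ℝ | ∀ᵐ y ∂volume.restrict (unitCell d),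
        ‖v p.1 y p.2‖ₑ ≤ V p.1} :=
      measurableSet_ae_right (p := fun (p : Esp d × ℝ) y => ‖v p.1 y p.2‖ₑ ≤ V p.1) hm1
    have h1 : ∀ᵐ x, ∀ᵐ τ ∂volume.restrict (Ioc (0 : ℝ) 1), ∀ᵐ y ∂volume.restrict (unitCell d),
        ‖v x y τ‖ₑ ≤ V x := by
      refine Filter.Eventually.of_forall fun x => ?_
      simpa only [enorm_norm] using ae_ae_enorm_le_cellNorm_top fun y τ => ‖v x y τ‖
    filter_upwards [(Measure.ae_ae_comm hm2).1 h1] with τ hτ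
    refine (Measure.ae_ae_comm (p := fun x y => ‖v x y τ‖ₑ ≤ V x) ?_).1 hτ
    exact hm1.preimage (f := fun p : Esp d × Esp d => ((p.1, τ), p.2)) (by fun_prop)
  have hcell : ∀ᵐ τ ∂volume.restrict (Ioc (0 : ℝ) 1), ∀ᵐ y ∂volume.restrict (unitCell d),
      ∀ᵐ x, ‖z‖ < Metric.infDist x Ωᶜ → ‖u x y τ - u (x - z) y τ‖ₑ ≤
        ‖z‖ₑ * ∫⁻ θ in Ioc (0 : ℝ) 1, Ω.indicator V (x - θ • z) := by
    filter_upwards [hbd, ae_restrict_of_ae hw] with τ hτ hwτ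
    filter_upwards [hτ, ae_restrict_of_ae hwτ] with y hy hwy
    have hum : Measurable fun x => u x y τ := hu.comp (f := fun x => (x, y, τ)) (by fun_prop)
    have hvm : Measurable fun x => v x y τ := hv.comp (f := fun x => (x, y, τ)) (by fun_prop)
    have hvi : IntegrableOn (fun x => v x y τ) Ω :=
      ⟨hvm.aestronglyMeasurable, (lintegral_mono_ae (ae_restrict_of_ae hy)).trans_lt
        (lt_top_iff_ne_top.2 hV)⟩
    have hsw : ∀ᵐ x : Esp d, ∀ᵐ θ : ℝ ∂volume.restrict (Ioc 0 1),
        ‖Ω.indicator (fun x => v x y τ) (x - θ • z)‖ₑ ≤ Ω.indicator V (x - θ • z) := by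
      refine (Measure.ae_ae_comm (p := fun (x : Esp d) (θ : ℝ) =>
        ‖Ω.indicator (fun x => v x y τ) (x - θ • z)‖ₑ ≤ Ω.indicator V (x - θ • z)) ?_).2 ?_
      · have hsm : Measurable fun p : Esp d × ℝ => p.1 - p.2 • z := by fun_prop
        exact measurableSet_le ((hvm.indicator hΩ).comp hsm).enorm ((hVm.indicator hΩ).comp hsm)
      · refine Filter.Eventually.of_forall fun θ => ?_
        have h1 := (measurePreserving_sub_right volume (θ • z)).quasiMeasurePreserving.ae hy
        filter_upwards [h1] with x hx
        by_cases hxΩ : x - θ • z ∈ Ω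
        · simpa [hxΩ] using hx
        · simp [hxΩ]
    filter_upwards [hwy.ae_enorm_sub_le hΩ hum (fun x => hM x y τ) hvm hvi z, hsw] with x h1 h2 h3
    exact (h1 h3).trans (mul_le_mul_right (lintegral_mono_ae h2) _)
  have hall := ae_ae_of_ae_cell (P := fun y τ => ∀ᵐ x, ‖z‖ < Metric.infDist x Ωᶜ →
    ‖u x y τ - u (x - z) y τ‖ₑ ≤ ‖z‖ₑ * ∫⁻ θ in Ioc (0 : ℝ) 1, Ω.indicator V (x - θ • z))
    (fun y τ => ⟨fun i => by simp only [(hper _ y τ).1], by simp only [(hper _ y τ).2]⟩) hcell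
  have hosc := ae_osc hε (measurableSet_ae_right
    (p := fun (p : Esp d × ℝ) x => ‖z‖ < Metric.infDist x Ωᶜ →
      ‖u x p.1 p.2 - u (x - z) p.1 p.2‖ₑ ≤
        ‖z‖ₑ * ∫⁻ θ in Ioc (0 : ℝ) 1, Ω.indicator V (x - θ • z))
    (hmeas.preimage (f := fun p : (Esp d × ℝ) × Esp d => (p.2, p.1.1, p.1.2)) (by fun_prop))) hall
  refine (Measure.ae_ae_comm ?_).1 hosc
  exact hmeas.preimage (f := fun p : (Esp d × ℝ) × Esp d => (p.2, ε⁻¹ • p.1.1, p.1.2 / ε ^ 2))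
    (by fun_prop)

end PointwiseBounds

section Smoothing

variable {d : ℕ} {φ₁ : ℝ → ℝ} {φ₂ : Esp d → ℝ} {ε : ℝ}

instance (d : ℕ) : (volume : Measure (Esp d × ℝ)).IsAddHaarMeasure :=
  inferInstanceAs ((volume : Measure (Esp d)).prod (volume : Measure ℝ)).IsAddHaarMeasure

instance (d : ℕ) : (volume : Measure (Esp d × ℝ)).IsNegInvariant :=
  Measure.IsAddHaarMeasure.isNegInvariant_of_regular _

/-- The space-time kernel of `S_ε`. -/
def kerR (φ₁ : ℝ → ℝ) (φ₂ : Esp d → ℝ) (ε : ℝ) (X : Esp d × ℝ) : ℝ :=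
  ((ε ^ d)⁻¹ * φ₂ (ε⁻¹ • X.1)) * ((ε ^ 2)⁻¹ * φ₁ (X.2 / ε ^ 2))

/-- The space-time kernel of `S_ε` with values in `ℝ≥0∞`. -/
def kerE (φ₁ : ℝ → ℝ) (φ₂ : Esp d → ℝ) (ε : ℝ) (X : Esp d × ℝ) : ℝ≥0∞ :=
  kerX φ₂ ε X.1 * kerT φ₁ ε X.2

lemma measurable_kerE (h₁ : GoodK1 φ₁) (h₂ : GoodK2 φ₂) : Measurable (kerE φ₁ φ₂ ε) :=
  ((measurable_kerX h₂).comp measurable_fst).mul ((measurable_kerT h₁).comp measurable_snd)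

lemma enorm_kerX (h₂ : GoodK2 φ₂) (hε : 0 < ε) (z : Esp d) :
    ‖(ε ^ d)⁻¹ * φ₂ (ε⁻¹ • z)‖ₑ = kerX φ₂ ε z :=
  Real.enorm_of_nonneg (mul_nonneg (by positivity) (h₂.2.2.2.1 _))

lemma enorm_kerT (h₁ : GoodK1 φ₁) (s : ℝ) :
    ‖(ε ^ 2)⁻¹ * φ₁ (s / ε ^ 2)‖ₑ = kerT φ₁ ε s :=
  Real.enorm_of_nonneg (mul_nonneg (by positivity) (h₁.2.2.2.1 _))

lemma enorm_kerR (h₁ : GoodK1 φ₁) (h₂ : GoodK2 φ₂) (hε : 0 < ε) (X : Esp d × ℝ) :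
    ‖kerR φ₁ φ₂ ε X‖ₑ = kerE φ₁ φ₂ ε X := by
  rw [kerR, enorm_mul, enorm_kerX h₂ hε, enorm_kerT h₁, kerE]

lemma continuous_kerR (h₁ : GoodK1 φ₁) (h₂ : GoodK2 φ₂) : Continuous (kerR φ₁ φ₂ ε) := by
  have := h₁.1.continuous
  have := h₂.1.continuous
  unfold kerR; fun_prop

lemma exists_norm_kerR_le (h₁ : GoodK1 φ₁) (h₂ : GoodK2 φ₂) :
    ∃ C, ∀ X, ‖kerR φ₁ φ₂ ε X‖ ≤ C := by
  obtain ⟨C₁, hC₁⟩ := h₁.2.1.exists_bound_of_continuous h₁.1.continuous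
  obtain ⟨C₂, hC₂⟩ := h₂.2.1.exists_bound_of_continuous h₂.1.continuous
  refine ⟨(‖(ε ^ d)⁻¹‖ * C₂) * (‖(ε ^ 2)⁻¹‖ * C₁), fun X => ?_⟩
  have : 0 ≤ C₂ := (norm_nonneg _).trans (hC₂ 0)
  rw [kerR, norm_mul, norm_mul, norm_mul]
  gcongr
  exacts [hC₂ _, hC₁ _]

variable {a : Esp d → ℝ → Esp d → ℝ → ℝ}

lemma Meas4.slice (ha : Meas4 a) (y : Esp d) (τ : ℝ) :
    Measurable fun X : Esp d × ℝ => a X.1 X.2 y τ :=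
  ha.comp (f := fun X : Esp d × ℝ => (X, y, τ)) (by fun_prop)

lemma Meas4.sx4 (ha : Meas4 a) (h₂ : GoodK2 φ₂) : Meas4 (Sx4 φ₂ ε a) := by
  have hφ := h₂.1.continuous
  have h1 : Measurable fun p : ((Esp d × ℝ) × Esp d × ℝ) × Esp d =>
      a (p.1.1.1 - p.2) p.1.1.2 p.1.2.1 p.1.2.2 * ((ε ^ d)⁻¹ * φ₂ (ε⁻¹ • p.2)) :=
    (ha.comp (f := fun p : ((Esp d × ℝ) × Esp d × ℝ) × Esp d =>
      ((p.1.1.1 - p.2, p.1.1.2), p.1.2)) (by fun_prop)).mul (by fun_prop)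
  exact h1.stronglyMeasurable.integral_prod_right.measurable

lemma Meas4.st4 (ha : Meas4 a) (h₁ : GoodK1 φ₁) : Meas4 (St4 φ₁ ε a) := by
  have hφ := h₁.1.continuous
  have h1 : Measurable fun p : ((Esp d × ℝ) × Esp d × ℝ) × ℝ =>
      a p.1.1.1 (p.1.1.2 - p.2) p.1.2.1 p.1.2.2 * ((ε ^ 2)⁻¹ * φ₁ (p.2 / ε ^ 2)) :=
    (ha.comp (f := fun p : ((Esp d × ℝ) × Esp d × ℝ) × ℝ =>
      ((p.1.1.1, p.1.1.2 - p.2), p.1.2)) (by fun_prop)).mul (by fun_prop)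
  exact h1.stronglyMeasurable.integral_prod_right.measurable

lemma Meas4.s4 (ha : Meas4 a) (h₁ : GoodK1 φ₁) (h₂ : GoodK2 φ₂) : Meas4 (S4 φ₁ φ₂ ε a) :=
  (ha.sx4 h₂).st4 h₁

lemma enorm_S4_le (ha : Meas4 a) (h₁ : GoodK1 φ₁) (h₂ : GoodK2 φ₂) (hε : 0 < ε)
    (X : Esp d × ℝ) (y : Esp d) (τ : ℝ) :
    ‖S4 φ₁ φ₂ ε a X.1 X.2 y τ‖ₑ ≤
      ∫⁻ Y : Esp d × ℝ, kerE φ₁ φ₂ ε (X - Y) * ‖a Y.1 Y.2 y τ‖ₑ := by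
  have hm : Measurable fun Z : Esp d × ℝ => kerE φ₁ φ₂ ε Z * ‖a (X - Z).1 (X - Z).2 y τ‖ₑ :=
    (measurable_kerE h₁ h₂).mul (((ha.slice y τ).comp (measurable_const.sub measurable_id)).enorm)
  rw [← lintegral_sub_left_eq_self _ X]
  simp only [_root_.sub_sub_cancel]
  rw [Measure.volume_eq_prod, lintegral_prod_symm' _ hm]
  refine (enorm_integral_le_lintegral_enorm _).trans (lintegral_mono fun s => ?_)
  rw [enorm_mul, enorm_kerT h₁]
  refine (mul_le_mul_left (enorm_integral_le_lintegral_enorm _) _).trans ?_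
  rw [← lintegral_mul_const' _ _ (by simp [kerT])]
  refine lintegral_mono fun z => ?_
  rw [enorm_mul, enorm_kerX h₂ hε, kerE, Prod.fst_sub, Prod.snd_sub]
  exact le_of_eq (by ring)

lemma S4_eq_integral {X : Esp d × ℝ} {y : Esp d} {τ : ℝ}
    (hi : Integrable fun Y : Esp d × ℝ => a Y.1 Y.2 y τ * kerR φ₁ φ₂ ε (X - Y)) :
    S4 φ₁ φ₂ ε a X.1 X.2 y τ = ∫ Y : Esp d × ℝ, a Y.1 Y.2 y τ * kerR φ₁ φ₂ ε (X - Y) := by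
  have hi2 := hi.comp_sub_left X
  rw [← integral_sub_left_eq_self _ _ X]
  simp only [_root_.sub_sub_cancel] at hi2 ⊢
  rw [Measure.volume_eq_prod] at hi2 ⊢
  rw [integral_prod_symm _ hi2]
  refine integral_congr_ae (Filter.Eventually.of_forall fun s => ?_)
  simp only [Sx4, kerR, ← mul_assoc, integral_mul_const, Prod.fst_sub, Prod.snd_sub]

/-- Pointwise bound for the commutator of `S_ε` with multiplication by `g`. -/
lemma enorm_commutator_le {g h : Esp d → ℝ → Esp d → ℝ → ℝ} (hg : Meas4 g)
    (h₁ : GoodK1 φ₁) (h₂ : GoodK2 φ₂) (hε : 0 < ε) {M : ℝ} (hM : ∀ x t y τ, |g x t y τ| ≤ M)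
    {A : Set (Esp d × ℝ)} (hA : MeasurableSet A) {X : Esp d × ℝ} {y : Esp d} {τ : ℝ}
    (hi : IntegrableOn (fun Y : Esp d × ℝ => h Y.1 Y.2 y τ) A)
    (hX : ∀ Y, kerE φ₁ φ₂ ε (X - Y) ≠ 0 → Y ∈ A) :
    ‖g X.1 X.2 y τ * S4 φ₁ φ₂ ε h X.1 X.2 y τ -
        S4 φ₁ φ₂ ε (fun x t y τ => g x t y τ * h x t y τ) X.1 X.2 y τ‖ₑ ≤
      ∫⁻ Y : Esp d × ℝ, kerE φ₁ φ₂ ε (X - Y) *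
        (‖g X.1 X.2 y τ - g Y.1 Y.2 y τ‖ₑ * ‖h Y.1 Y.2 y τ‖ₑ) := by
  obtain ⟨C, hC⟩ := exists_norm_kerR_le (ε := ε) h₁ h₂
  have hker : Continuous fun Y => kerR φ₁ φ₂ ε (X - Y) :=
    (continuous_kerR h₁ h₂).comp (by fun_prop)
  have hi1 : Integrable fun Y : Esp d × ℝ => h Y.1 Y.2 y τ * kerR φ₁ φ₂ ε (X - Y) := by
    refine (((integrable_indicator_iff hA).2 hi).mul_bdd (c := C) hker.aestronglyMeasurable
      (Filter.Eventually.of_forall fun Y => hC _)).congr (Filter.Eventually.of_forall fun Y => ?_)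
    by_cases hY : Y ∈ A
    · simp [hY]
    · have : kerR φ₁ φ₂ ε (X - Y) = 0 := by
        rw [← enorm_eq_zero, enorm_kerR h₁ h₂ hε]
        exact not_ne_iff.1 (mt (hX Y) hY)
      simp [this]
  have hi2 : Integrable fun Y : Esp d × ℝ =>
      (g Y.1 Y.2 y τ * h Y.1 Y.2 y τ) * kerR φ₁ φ₂ ε (X - Y) := by
    simp_rw [mul_assoc]
    exact hi1.bdd_mul (c := M) (hg.slice y τ).aestronglyMeasurable
      (Filter.Eventually.of_forall fun Y => hM _ _ _ _)
  rw [S4_eq_integral hi1, S4_eq_integral (a := fun x t y τ => g x t y τ * h x t y τ) hi2,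
    ← integral_const_mul, ← integral_sub (hi1.const_mul _) hi2]
  refine (enorm_integral_le_lintegral_enorm _).trans (le_of_eq (lintegral_congr fun Y => ?_))
  rw [← enorm_kerR h₁ h₂ hε, ← enorm_mul, ← enorm_mul]
  congr 1; ring

end Smoothing

section MixedNorms

variable {d : ℕ} {φ₁ : ℝ → ℝ} {φ₂ : Esp d → ℝ} {ε : ℝ}

lemma mixNorm_eq_indicator {q p : ℝ≥0∞} (hp : p ≠ 0) {A : Set (Esp d × ℝ)} (hA : MeasurableSet A)
    (F : Esp d → ℝ → ℝ≥0∞) :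
    mixNorm q p A F = eLp q volume fun t => eLp p volume fun x =>
      A.indicator (fun X => F X.1 X.2) (x, t) := by
  unfold mixNorm
  congr 1
  ext t
  rw [← eLp_indicator hp (s := {x | (x, t) ∈ A}) (hA.preimage (by fun_prop))]
  rfl

lemma ae_le_mixNorm_top {A : Set (Esp d × ℝ)} (hA : MeasurableSet A) {F : Esp d → ℝ → ℝ≥0∞}
    (hF : Measurable fun X : Esp d × ℝ => F X.1 X.2) :
    ∀ᵐ X : Esp d × ℝ, X ∈ A → F X.1 X.2 ≤ mixNorm ⊤ ⊤ A F := by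
  refine ae_prod_of_ae_ae_symm (p := fun x t => (x, t) ∈ A → F x t ≤ mixNorm ⊤ ⊤ A F)
    (hA.imp (measurableSet_le hF measurable_const)) ?_
  have h1 := ENNReal.ae_le_essSup (μ := (volume : Measure ℝ))
    (fun t => eLp ⊤ (volume.restrict {x | (x, t) ∈ A}) fun x => F x t)
  filter_upwards [h1] with t ht
  have h2 := ENNReal.ae_le_essSup (μ := (volume : Measure (Esp d)).restrict {x | (x, t) ∈ A})
    (fun x => F x t)
  rw [ae_restrict_iff' (s := {x | (x, t) ∈ A}) (hA.preimage (by fun_prop))] at h2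
  filter_upwards [h2] with x hx hxA
  refine (hx hxA).trans (le_trans (le_of_eq ?_) ht)
  rw [eLp_top]

lemma eLp_two_le_eLp {α : Type*} [MeasurableSpace α] {μ : Measure α} [IsProbabilityMeasure μ]
    {s : ℝ≥0∞} (hs : 2 ≤ s) {f : α → ℝ≥0∞} (hf : Measurable f) : eLp 2 μ f ≤ eLp s μ f := by
  have hs' : s⁻¹ ≤ 2⁻¹ := ENNReal.inv_le_inv.2 hs
  have h1 : (2 : ℝ≥0∞)⁻¹ = s⁻¹ + ((2⁻¹ - s⁻¹)⁻¹)⁻¹ := by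
    rw [inv_inv, add_tsub_cancel_of_le hs']
  have hb : (2⁻¹ - s⁻¹)⁻¹ ≠ 0 := ENNReal.inv_ne_zero.2 (ne_top_of_le_ne_top (by simp) tsub_le_self)
  have h2 := eLp_mul_le (μ := μ) (f := f) (g := fun _ => 1)
    (show s ≠ 0 from (lt_of_lt_of_le (by simp) hs).ne') hb h1 hf.aemeasurable aemeasurable_const
  simp only [mul_one] at h2
  refine h2.trans (le_of_eq ?_)
  by_cases hb2 : (2⁻¹ - s⁻¹)⁻¹ = ∞
  · rw [hb2, eLp_top, essSup_const _ (NeZero.ne μ), mul_one]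
  · simp [eLp_of_ne_top hb2]

lemma lintegral_cell_sq_le {s : ℝ≥0∞} (hs : 2 ≤ s) {a : Esp d → ℝ → ℝ}
    (ha : Measurable fun p : Esp d × ℝ => a p.1 p.2) :
    ∫⁻ τ in Ioc (0 : ℝ) 1, ∫⁻ y in unitCell d, ‖a y τ‖ₑ ^ 2 ≤ cellNorm s 2 a ^ 2 := by
  have : IsProbabilityMeasure (volume.restrict (Ioc (0 : ℝ) 1)) := ⟨by simp⟩
  have hm : Measurable fun τ => eLp 2 (volume.restrict (unitCell d))
      fun y => (‖a y τ‖₊ : ℝ≥0∞) :=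
    measurable_eLp_right (f := fun τ y => (‖a y τ‖₊ : ℝ≥0∞))
      (ha.comp (f := fun p : ℝ × Esp d => (p.2, p.1)) (by fun_prop)).enorm
  have h1 := eLp_two_le_eLp (μ := volume.restrict (Ioc (0 : ℝ) 1)) hs hm
  refine le_trans (le_of_eq ?_) (pow_le_pow_left₀ (zero_le) h1 2)
  have hsq : ∀ x : ℝ≥0∞, (x ^ (2⁻¹ : ℝ)) ^ 2 = x := fun x => by
    rw [← ENNReal.rpow_natCast, ← ENNReal.rpow_mul]; simp
  simp [eLp_of_ne_top, hsq]
  rfl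

lemma measurable_enorm_sq {a : Esp d → ℝ → ℝ}
    (ha : Measurable fun p : Esp d × ℝ => a p.1 p.2) :
    Measurable fun p : Esp d × ℝ => ‖a p.1 p.2‖ₑ ^ 2 := ha.enorm.pow_const 2

lemma lintegral_kerE_osc_sq_le (h₁ : GoodK1 φ₁) (h₂ : GoodK2 φ₂) (hε : 0 < ε) {M₁ M₂ : ℝ}
    (hM₁ : ∀ y, φ₁ y ≤ M₁) (hM₂ : ∀ y, φ₂ y ≤ M₂) {s : ℝ≥0∞} (hs : 2 ≤ s) {a : Esp d → ℝ → ℝ}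
    (ha : Measurable fun p : Esp d × ℝ => a p.1 p.2)
    (hper : ∀ y τ, (∀ i, a (y + EuclideanSpace.single i 1) τ = a y τ) ∧ a y (τ + 1) = a y τ)
    (Y : Esp d × ℝ) :
    ∫⁻ X : Esp d × ℝ, kerE φ₁ φ₂ ε (X - Y) * ‖a (ε⁻¹ • X.1) (X.2 / ε ^ 2)‖ₑ ^ 2 ≤
      ENNReal.ofReal M₁ * ENNReal.ofReal M₂ * cellNorm s 2 a ^ 2 := by
  have hsq := measurable_enorm_sq ha
  have hm : Measurable fun X : Esp d × ℝ =>
      kerE φ₁ φ₂ ε (X - Y) * ‖a (ε⁻¹ • X.1) (X.2 / ε ^ 2)‖ₑ ^ 2 :=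
    ((measurable_kerE h₁ h₂).comp (measurable_id.sub_const Y)).mul
      (hsq.comp (f := fun X : Esp d × ℝ => (ε⁻¹ • X.1, X.2 / ε ^ 2)) (by fun_prop))
  have hmy : Measurable fun τ => ∫⁻ y in unitCell d, ‖a y τ‖ₑ ^ 2 :=
    Measurable.lintegral_prod_right' (f := fun p : ℝ × Esp d => ‖a p.2 p.1‖ₑ ^ 2)
      (hsq.comp (f := fun p : ℝ × Esp d => (p.2, p.1)) (by fun_prop))
  rw [Measure.volume_eq_prod, lintegral_prod_symm' _ hm]
  calc _ ≤ ∫⁻ t, kerT φ₁ ε (t - Y.2) *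
        (ENNReal.ofReal M₂ * ∫⁻ y in unitCell d, ‖a y (t / ε ^ 2)‖ₑ ^ 2) := by
        refine lintegral_mono fun t => ?_
        have h1 := lintegral_kerX_periodic_le h₂ hε hM₂ (u := fun y => ‖a y (t / ε ^ 2)‖ₑ ^ 2)
          (hsq.comp (f := fun y => (y, t / ε ^ 2)) (by fun_prop))
          (fun y i => by rw [(hper y _).1]) Y.1
        refine le_trans (le_of_eq ?_) (mul_le_mul_right h1 _)
        rw [← lintegral_const_mul' _ _ (by simp [kerT])]
        refine lintegral_congr fun x => ?_
        rw [kerE, Prod.fst_sub, Prod.snd_sub]; ring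
    _ = ENNReal.ofReal M₂ * ∫⁻ t, kerT φ₁ ε (t - Y.2) *
        ∫⁻ y in unitCell d, ‖a y (t / ε ^ 2)‖ₑ ^ 2 := by
        rw [← lintegral_const_mul' _ _ (by simp)]
        exact lintegral_congr fun t => by ring
    _ ≤ ENNReal.ofReal M₂ * (ENNReal.ofReal M₁ * cellNorm s 2 a ^ 2) := by
        gcongr
        refine (lintegral_kerT_periodic_le h₁ hε hM₁ hmy
          (fun τ => by simp only [(hper _ τ).2]) Y.2).trans ?_
        gcongr
        exact lintegral_cell_sq_le hs ha
    _ = _ := by ring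

/-- Cauchy–Schwarz for the smoothing kernel against an oscillating factor. -/
lemma lintegral_kerE_mul_osc_le (h₁ : GoodK1 φ₁) (h₂ : GoodK2 φ₂) (hε : 0 < ε) {M₁ M₂ : ℝ}
    (hM₁ : ∀ y, φ₁ y ≤ M₁) (hM₂ : ∀ y, φ₂ y ≤ M₂) {s : ℝ≥0∞} (hs : 2 ≤ s) {a : Esp d → ℝ → ℝ}
    (ha : Measurable fun p : Esp d × ℝ => a p.1 p.2)
    (hper : ∀ y τ, (∀ i, a (y + EuclideanSpace.single i 1) τ = a y τ) ∧ a y (τ + 1) = a y τ)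
    {b : Esp d × ℝ → ℝ≥0∞} (hb : Measurable b) (Y : Esp d × ℝ) :
    ∫⁻ X : Esp d × ℝ, kerE φ₁ φ₂ ε (X - Y) * (b X * ‖a (ε⁻¹ • X.1) (X.2 / ε ^ 2)‖ₑ) ≤
      (∫⁻ X : Esp d × ℝ, kerE φ₁ φ₂ ε (X - Y) * b X ^ 2) ^ (1 / 2 : ℝ) *
        ((ENNReal.ofReal M₁ * ENNReal.ofReal M₂) ^ (1 / 2 : ℝ) * cellNorm s 2 a) := by
  have hk : Measurable fun X : Esp d × ℝ => kerE φ₁ φ₂ ε (X - Y) :=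
    (measurable_kerE h₁ h₂).comp (measurable_id.sub_const Y)
  have hao : Measurable fun X : Esp d × ℝ => ‖a (ε⁻¹ • X.1) (X.2 / ε ^ 2)‖ₑ :=
    (ha.comp (f := fun X : Esp d × ℝ => (ε⁻¹ • X.1, X.2 / ε ^ 2)) (by fun_prop)).enorm
  have h := ENNReal.lintegral_mul_le_Lp_mul_Lq
    (volume.withDensity fun X => kerE φ₁ φ₂ ε (X - Y)) Real.HolderConjugate.two_two
    hb.aemeasurable hao.aemeasurable
  simp only [ENNReal.rpow_ofNat, Pi.mul_apply] at h
  have hwd : ∀ F : Esp d × ℝ → ℝ≥0∞, Measurable F →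
      ∫⁻ X, F X ∂(volume.withDensity fun X => kerE φ₁ φ₂ ε (X - Y)) =
        ∫⁻ X, kerE φ₁ φ₂ ε (X - Y) * F X := fun F hF =>
    lintegral_withDensity_eq_lintegral_mul _ hk hF
  rw [hwd (fun X => b X * ‖a (ε⁻¹ • X.1) (X.2 / ε ^ 2)‖ₑ) (hb.mul hao),
    hwd _ (hb.pow_const 2), hwd _ (hao.pow_const 2)] at h
  refine h.trans (mul_le_mul_right ?_ _)
  refine (ENNReal.rpow_le_rpow (lintegral_kerE_osc_sq_le h₁ h₂ hε hM₁ hM₂ hs ha hper Y)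
    (by norm_num)).trans (le_of_eq ?_)
  rw [ENNReal.mul_rpow_of_nonneg _ _ (by norm_num), ← ENNReal.rpow_natCast, ← ENNReal.rpow_mul]
  simp

/-- Integrability in the macroscopic variables along almost every oscillating point. -/
lemma ae_osc_integrableOn (hε : 0 < ε) {s : ℝ≥0∞} (hs : 2 ≤ s) {h : Esp d → ℝ → Esp d → ℝ → ℝ}
    (hh : Meas4 h) (hper : Per4 h) {A : Set (Esp d × ℝ)} (hA : MeasurableSet A)
    (hAf : volume A ≠ ∞) (hH : mixNorm ⊤ ⊤ A (fun x t => cellNorm s 2 (h x t)) ≠ ∞) :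
    ∀ᵐ X : Esp d × ℝ,
      IntegrableOn (fun Y : Esp d × ℝ => h Y.1 Y.2 (ε⁻¹ • X.1) (X.2 / ε ^ 2)) A := by
  set H := mixNorm ⊤ ⊤ A (fun x t => cellNorm s 2 (h x t))
  have hm4 : Measurable fun w : (Esp d × ℝ) × Esp d × ℝ => ‖h w.1.1 w.1.2 w.2.1 w.2.2‖ₑ ^ 2 :=
    hh.enorm.pow_const 2
  have hRm : Measurable fun w : Esp d × ℝ => ∫⁻ Y in A, ‖h Y.1 Y.2 w.1 w.2‖ₑ ^ 2 :=
    Measurable.lintegral_prod_left' hm4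
  have hcn : Measurable fun X : Esp d × ℝ => cellNorm s 2 (h X.1 X.2) :=
    measurable_cellNorm (a := fun X : Esp d × ℝ => h X.1 X.2) hh
  have hcell : ∫⁻ τ in Ioc (0 : ℝ) 1, ∫⁻ y in unitCell d, ∫⁻ Y in A, ‖h Y.1 Y.2 y τ‖ₑ ^ 2 ≠ ∞ := by
    have h1 : ∫⁻ τ in Ioc (0 : ℝ) 1, ∫⁻ y in unitCell d, ∫⁻ Y in A, ‖h Y.1 Y.2 y τ‖ₑ ^ 2 =
        ∫⁻ Y in A, ∫⁻ τ in Ioc (0 : ℝ) 1, ∫⁻ y in unitCell d, ‖h Y.1 Y.2 y τ‖ₑ ^ 2 := by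
      have hin : ∀ τ, ∫⁻ y in unitCell d, ∫⁻ Y in A, ‖h Y.1 Y.2 y τ‖ₑ ^ 2 =
          ∫⁻ Y in A, ∫⁻ y in unitCell d, ‖h Y.1 Y.2 y τ‖ₑ ^ 2 := fun τ =>
        lintegral_lintegral_swap (hm4.comp
          (f := fun p : Esp d × Esp d × ℝ => (p.2, p.1, τ)) (by fun_prop)).aemeasurable
      simp_rw [hin]
      refine lintegral_lintegral_swap (Measurable.aemeasurable ?_)
      exact Measurable.lintegral_prod_right'
        (f := fun p : (ℝ × Esp d × ℝ) × Esp d => ‖h p.1.2.1 p.1.2.2 p.2 p.1.1‖ₑ ^ 2)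
        (hm4.comp (f := fun p : (ℝ × Esp d × ℝ) × Esp d => (p.1.2, p.2, p.1.1)) (by fun_prop))
    rw [h1]
    have h2 : ∫⁻ Y in A, ∫⁻ τ in Ioc (0 : ℝ) 1, ∫⁻ y in unitCell d, ‖h Y.1 Y.2 y τ‖ₑ ^ 2 ≤
        ∫⁻ _ in A, H ^ 2 := by
      refine lintegral_mono_ae ((ae_restrict_iff' hA).2 ?_)
      filter_upwards [ae_le_mixNorm_top (F := fun x t => cellNorm s 2 (h x t)) hA hcn] with Y hY hYA
      exact (lintegral_cell_sq_le hs (hh.comp (f := fun p : Esp d × ℝ => (Y, p))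
        (by fun_prop))).trans (pow_le_pow_left₀ (zero_le) (hY hYA) 2)
    refine ne_top_of_le_ne_top ?_ h2
    rw [setLIntegral_const]
    exact ENNReal.mul_ne_top (ENNReal.pow_ne_top hH) hAf
  have hcell2 : ∀ᵐ τ ∂volume.restrict (Ioc (0 : ℝ) 1), ∀ᵐ y ∂volume.restrict (unitCell d),
      ∫⁻ Y in A, ‖h Y.1 Y.2 y τ‖ₑ ^ 2 < ∞ := by
    have hmτ : Measurable fun τ => ∫⁻ y in unitCell d, ∫⁻ Y in A, ‖h Y.1 Y.2 y τ‖ₑ ^ 2 :=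
      Measurable.lintegral_prod_right'
        (f := fun p : ℝ × Esp d => ∫⁻ Y in A, ‖h Y.1 Y.2 p.2 p.1‖ₑ ^ 2)
        (hRm.comp (f := fun p : ℝ × Esp d => (p.2, p.1)) (by fun_prop))
    filter_upwards [ae_lt_top hmτ hcell] with τ hτ
    exact ae_lt_top (hRm.comp (f := fun y => (y, τ)) (by fun_prop)) hτ.ne
  have hall := ae_ae_of_ae_cell (P := fun y τ => ∫⁻ Y in A, ‖h Y.1 Y.2 y τ‖ₑ ^ 2 < ∞)
    (fun y τ => ⟨fun i => by simp only [(hper _ _ y τ).1], by simp only [(hper _ _ y τ).2]⟩) hcell2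
  filter_upwards [ae_osc hε (measurableSet_lt hRm measurable_const) hall] with X hX
  refine ⟨(hh.slice _ _).aestronglyMeasurable, ?_⟩
  have hle : ∀ x : ℝ≥0∞, x ≤ 1 + x ^ 2 := fun x => by
    rcases le_total x 1 with hx | hx
    · exact hx.trans le_self_add
    · calc x = x * 1 := (mul_one x).symm
        _ ≤ x * x := by gcongr
        _ ≤ _ := by rw [← sq]; exact le_add_self
  refine (lintegral_mono fun Y => hle _).trans_lt ?_
  rw [lintegral_add_left measurable_const]
  refine ENNReal.add_lt_top.2 ⟨?_, hX⟩
  simpa using lt_top_iff_ne_top.2 hAf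

end MixedNorms

section KernelEstimates

variable {d : ℕ} {φ₁ : ℝ → ℝ} {φ₂ : Esp d → ℝ} {ε : ℝ}

lemma eLp_comp_add_right {E : Type*} [AddGroup E] [MeasurableSpace E] [MeasurableAdd E]
    {μ : Measure E} [μ.IsAddRightInvariant] {p : ℝ≥0∞} {f : E → ℝ≥0∞} (hf : Measurable f) (z : E) :
    eLp p μ (fun x => f (x + z)) = eLp p μ f := by
  by_cases hp : p = ∞
  · subst hp
    have hmp := measurePreserving_add_right μ z
    rw [eLp_top, eLp_top]
    conv_rhs => rw [← hmp.map_eq]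
    rw [essSup_map_measure_of_measurable hf hmp.measurable.aemeasurable]
    rfl
  · rw [eLp_of_ne_top hp, eLp_of_ne_top hp,
      lintegral_add_right_eq_self (fun x => f x ^ p.toReal) z]

lemma eLp_mixed_mul_le {q p q₁ p₁ q₂ p₂ : ℝ≥0∞} (hq₁ : q₁ ≠ 0) (hp₁ : p₁ ≠ 0) (hq₂ : q₂ ≠ 0)
    (hp₂ : p₂ ≠ 0) (hq : q⁻¹ = q₁⁻¹ + q₂⁻¹) (hp : p⁻¹ = p₁⁻¹ + p₂⁻¹)
    {a b : Esp d × ℝ → ℝ≥0∞} (ha : Measurable a) (hb : Measurable b) :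
    (eLp q volume fun t => eLp p volume fun x => a (x, t) * b (x, t)) ≤
      (eLp q₁ volume fun t => eLp p₁ volume fun x => a (x, t)) *
        eLp q₂ volume fun t => eLp p₂ volume fun x => b (x, t) := by
  have hm : ∀ {c : Esp d × ℝ → ℝ≥0∞} {r : ℝ≥0∞}, Measurable c →
      Measurable fun t => eLp r volume fun x => c (x, t) := fun hc =>
    measurable_eLp_right (f := fun t x => _) (hc.comp measurable_swap)
  refine le_trans (eLp_mono_ae (Filter.Eventually.of_forall fun t => ?_))
    (eLp_mul_le hq₁ hq₂ hq (hm ha).aemeasurable (hm hb).aemeasurable)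
  exact eLp_mul_le hp₁ hp₂ hp (by fun_prop) (by fun_prop)

lemma isProbabilityMeasure_kerX (h₂ : GoodK2 φ₂) (hε : 0 < ε) :
    IsProbabilityMeasure (volume.withDensity (kerX φ₂ ε)) :=
  ⟨by rw [withDensity_apply _ MeasurableSet.univ, Measure.restrict_univ, lintegral_kerX h₂ hε]⟩

lemma lintegral_kerE (h₁ : GoodK1 φ₁) (h₂ : GoodK2 φ₂) (hε : 0 < ε) :
    ∫⁻ X, kerE φ₁ φ₂ ε X = 1 := by
  rw [Measure.volume_eq_prod]
  simp only [kerE]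
  rw [lintegral_prod_mul (measurable_kerX h₂).aemeasurable (measurable_kerT h₁).aemeasurable,
    lintegral_kerX h₂ hε, lintegral_kerT h₁ hε, one_mul]

lemma isProbabilityMeasure_kerE (h₁ : GoodK1 φ₁) (h₂ : GoodK2 φ₂) (hε : 0 < ε) :
    IsProbabilityMeasure (volume.withDensity (kerE φ₁ φ₂ ε)) :=
  ⟨by rw [withDensity_apply _ MeasurableSet.univ, Measure.restrict_univ, lintegral_kerE h₁ h₂ hε]⟩

lemma eLp_mixed_smoothing_le (h₁ : GoodK1 φ₁) (h₂ : GoodK2 φ₂) (hε : 0 < ε) {q p : ℝ≥0∞}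
    (hq : 1 ≤ q) (hp : 1 ≤ p) {b : Esp d × ℝ → ℝ≥0∞} (hb : Measurable b) :
    (eLp q volume fun t => eLp p volume fun x => ∫⁻ X, kerE φ₁ φ₂ ε (X - (x, t)) * b X) ≤
      eLp q volume fun t => eLp p volume fun x => b (x, t) := by
  have hprob := isProbabilityMeasure_kerE h₁ h₂ hε
  set ν := volume.withDensity (kerE φ₁ φ₂ ε) with hν
  have hβ : Measurable fun t => eLp p volume fun x => b (x, t) :=
    measurable_eLp_right (f := fun t x => b (x, t)) (hb.comp measurable_swap)
  have h3 : ∀ x t, ∫⁻ X, kerE φ₁ φ₂ ε (X - (x, t)) * b X = ∫⁻ Z, b (x + Z.1, t + Z.2) ∂ν := by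
    intro x t
    rw [hν, lintegral_withDensity_eq_lintegral_mul _ (measurable_kerE h₁ h₂)
      (g := fun Z => b (x + Z.1, t + Z.2)) (by fun_prop),
      ← lintegral_add_right_eq_self (fun X => kerE φ₁ φ₂ ε (X - (x, t)) * b X) (x, t)]
    refine lintegral_congr fun Z => ?_
    simp only [add_sub_cancel_right, Pi.mul_apply]
    congr 2
    rw [add_comm]; rfl
  simp_rw [h3]
  calc _ ≤ eLp q volume fun t => ∫⁻ Z, eLp p volume (fun x => b (x, t + Z.2)) ∂ν := by
        refine eLp_mono_ae (Filter.Eventually.of_forall fun t => ?_)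
        refine (eLp_lintegral_le (ν := ν) hp
          (a := fun x Z => b (x + Z.1, t + Z.2)) (by fun_prop)).trans (le_of_eq ?_)
        refine lintegral_congr fun Z => ?_
        exact eLp_comp_add_right (f := fun x => b (x, t + Z.2)) (by fun_prop) Z.1
    _ ≤ ∫⁻ Z, eLp q volume (fun t => eLp p volume fun x => b (x, t + Z.2)) ∂ν :=
        eLp_lintegral_le (ν := ν) hq
          (a := fun t (Z : Esp d × ℝ) => eLp p volume fun x => b (x, t + Z.2))
          (hβ.comp (measurable_fst.add measurable_snd.snd))
    _ = _ := by
        have h5 : ∀ Z : Esp d × ℝ, eLp q volume (fun t => eLp p volume fun x => b (x, t + Z.2)) =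
            eLp q volume fun t => eLp p volume fun x => b (x, t) := fun Z =>
          eLp_comp_add_right (f := fun t => eLp p volume fun x => b (x, t)) hβ Z.2
        simp_rw [h5]
        rw [lintegral_const, measure_univ, mul_one]

/-- The quadratic mean of `b` against the smoothing kernel is bounded on mixed norms. -/
lemma eLp_mixed_smoothing_sq_le (h₁ : GoodK1 φ₁) (h₂ : GoodK2 φ₂) (hε : 0 < ε) {q p : ℝ≥0∞}
    (hq : 2 ≤ q) (hp : 2 ≤ p) {b : Esp d × ℝ → ℝ≥0∞} (hb : Measurable b) :
    (eLp q volume fun t => eLp p volume fun x =>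
        (∫⁻ X, kerE φ₁ φ₂ ε (X - (x, t)) * b X ^ 2) ^ (1 / 2 : ℝ)) ≤
      eLp q volume fun t => eLp p volume fun x => b (x, t) := by
  have h2 : ∀ {r : ℝ≥0∞}, 2 ≤ r → 1 ≤ r / 2 := fun h => by
    rw [ENNReal.le_div_iff_mul_le (by simp) (by simp), one_mul]; exact h
  simp_rw [eLp_rpow_half]
  refine (ENNReal.rpow_le_rpow (eLp_mixed_smoothing_le h₁ h₂ hε (h2 hq) (h2 hp) (hb.pow_const 2))
    (by norm_num)).trans (le_of_eq ?_)
  rw [← eLp_rpow_half]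
  simp_rw [eLp_half_sq]

lemma eLp_segment_mean_le (h₂ : GoodK2 φ₂) (hε : 0 < ε) {p : ℝ≥0∞} (hp : 1 ≤ p)
    {W : Esp d → ℝ≥0∞} (hW : Measurable W) :
    (eLp p volume fun x => ∫⁻ z, kerX φ₂ ε z * ∫⁻ θ in Ioc (0 : ℝ) 1, W (x - θ • z)) ≤
      eLp p volume W := by
  have hprob := isProbabilityMeasure_kerX h₂ hε
  have hprob2 : IsProbabilityMeasure (volume.restrict (Ioc (0 : ℝ) 1)) := ⟨by simp⟩
  set ν := (volume.withDensity (kerX φ₂ ε)).prod (volume.restrict (Ioc (0 : ℝ) 1)) with hν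
  have hm : Measurable fun Q : Esp d × Esp d × ℝ => W (Q.1 - Q.2.2 • Q.2.1) := by fun_prop
  have h3 : ∀ x, ∫⁻ z, kerX φ₂ ε z * ∫⁻ θ in Ioc (0 : ℝ) 1, W (x - θ • z) =
      ∫⁻ Z, W (x - Z.2 • Z.1) ∂ν := by
    intro x
    rw [hν, lintegral_prod _ (by fun_prop), lintegral_withDensity_eq_lintegral_mul _
      (measurable_kerX h₂)]
    · rfl
    · exact Measurable.lintegral_prod_right' (f := fun Z : Esp d × ℝ => W (x - Z.2 • Z.1))
        (by fun_prop)
  simp_rw [h3]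
  refine (eLp_lintegral_le (ν := ν) hp (a := fun x (Z : Esp d × ℝ) => W (x - Z.2 • Z.1)) hm).trans
    (le_of_eq ?_)
  simp_rw [sub_eq_add_neg]
  rw [lintegral_congr fun Z : Esp d × ℝ => eLp_comp_add_right hW (-(Z.2 • Z.1)), lintegral_const]
  simp

/-- Time averages of increments at scale `ε²` are controlled by the fractional seminorm. -/
lemma eLp_time_increment_le (h₁ : GoodK1 φ₁) (hε : 0 < ε) {M : ℝ} (hM0 : 0 < M)
    (hM : ∀ s, φ₁ s ≤ M) (I : Set ℝ) {N : ℝ → ℝ → ℝ≥0∞}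
    (hN : Measurable fun p : ℝ × ℝ => N p.1 p.2) :
    (eLp 2 (volume.restrict I) fun t₁ => ∫⁻ t₂ in I, kerT φ₁ ε (t₁ - t₂) * N t₁ t₂) ≤
      ENNReal.ofReal M ^ (1 / 2 : ℝ) * ENNReal.ofReal ε * fracSemi 2 I N := by
  have hk : ∀ t₁, Measurable fun t₂ => kerT φ₁ ε (t₁ - t₂) := fun t₁ =>
    (measurable_kerT h₁).comp (by fun_prop)
  have hN' : ∀ t₁, Measurable (N t₁) := fun t₁ => hN.comp (f := fun t₂ => (t₁, t₂)) (by fun_prop)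
  have hkb : ∀ s, kerT φ₁ ε s ≤ ENNReal.ofReal (M * ε ^ 2) / ENNReal.ofReal (|s| ^ (2 : ℝ)) := by
    intro s
    have hc : ENNReal.ofReal (M * ε ^ 2) ≠ 0 := by
      rw [ne_eq, ENNReal.ofReal_eq_zero, not_le]; positivity
    rw [ENNReal.le_div_iff_mul_le (Or.inr hc) (Or.inl ENNReal.ofReal_ne_top)]
    by_cases hs : kerT φ₁ ε s = 0
    · simp [hs]
    · have hs2 := abs_lt_of_kerT_ne_zero h₁ hε hs
      rw [kerT, ← ENNReal.ofReal_mul (mul_nonneg (by positivity) (h₁.2.2.2.1 _))]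
      refine ENNReal.ofReal_le_ofReal ?_
      have h4 : |s| ^ (2 : ℝ) ≤ ε ^ 2 * ε ^ 2 := by
        rw [Real.rpow_two, ← sq]
        refine pow_le_pow_left₀ (abs_nonneg s) ?_ 2
        have : 0 < ε ^ 2 := by positivity
        linarith
      calc (ε ^ 2)⁻¹ * φ₁ (s / ε ^ 2) * |s| ^ (2 : ℝ) ≤ (ε ^ 2)⁻¹ * M * (ε ^ 2 * ε ^ 2) := by
            gcongr
            exact hM _
        _ = M * ε ^ 2 := by field_simp
  have hsq : ∀ t₁, (∫⁻ t₂ in I, kerT φ₁ ε (t₁ - t₂) * N t₁ t₂) ^ (2 : ℝ) ≤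
      ENNReal.ofReal (M * ε ^ 2) *
        ∫⁻ t₂ in I, N t₁ t₂ ^ (2 : ℝ) / ENNReal.ofReal (|t₁ - t₂| ^ (2 : ℝ)) := by
    intro t₁
    have hwd : ∀ F : ℝ → ℝ≥0∞, Measurable F →
        ∫⁻ t₂, F t₂ ∂((volume.restrict I).withDensity fun t₂ => kerT φ₁ ε (t₁ - t₂)) =
          ∫⁻ t₂ in I, kerT φ₁ ε (t₁ - t₂) * F t₂ := fun F hF =>
      lintegral_withDensity_eq_lintegral_mul _ (hk t₁) hF
    have h := ENNReal.lintegral_mul_le_Lp_mul_Lq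
      ((volume.restrict I).withDensity fun t₂ => kerT φ₁ ε (t₁ - t₂)) Real.HolderConjugate.two_two
      (hN' t₁).aemeasurable (aemeasurable_const (b := 1))
    simp only [Pi.mul_apply, mul_one, ENNReal.one_rpow] at h
    rw [hwd _ (hN' t₁), hwd _ ((hN' t₁).pow_const _), hwd _ measurable_const] at h
    have h1 : ∫⁻ t₂ in I, kerT φ₁ ε (t₁ - t₂) * 1 ≤ 1 := by
      simp only [mul_one]
      refine (setLIntegral_le_lintegral _ _).trans ?_
      rw [lintegral_sub_left_eq_self, lintegral_kerT h₁ hε]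
    have h2 := h.trans (mul_le_mul_right (ENNReal.rpow_le_one h1 (by norm_num)) _)
    rw [mul_one] at h2
    refine (ENNReal.rpow_le_rpow h2 (by norm_num)).trans ?_
    rw [← ENNReal.rpow_mul]
    norm_num only [ENNReal.rpow_one]
    rw [← lintegral_const_mul' _ _ ENNReal.ofReal_ne_top]
    refine lintegral_mono fun t₂ => ?_
    refine (mul_le_mul_left (hkb _) _).trans (le_of_eq ?_)
    rw [div_eq_mul_inv, div_eq_mul_inv]; ring
  have h2t : (2 : ℝ≥0∞) ≠ ∞ := by simp
  rw [eLp_of_ne_top h2t, fracSemi, if_neg h2t]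
  have he : (1 + (2 : ℝ≥0∞).toReal / 2 : ℝ) = 2 := by norm_num
  simp only [ENNReal.toReal_ofNat] at he ⊢
  rw [he]
  refine (ENNReal.rpow_le_rpow (lintegral_mono hsq) (by norm_num)).trans (le_of_eq ?_)
  rw [lintegral_const_mul' _ _ ENNReal.ofReal_ne_top,
    ENNReal.mul_rpow_of_nonneg _ _ (by norm_num), ENNReal.ofReal_mul hM0.le,
    ENNReal.mul_rpow_of_nonneg _ _ (by norm_num), ENNReal.ofReal_pow hε.le]
  congr 2
  rw [← ENNReal.rpow_natCast, ← ENNReal.rpow_mul]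
  simp

end KernelEstimates

section Reduction

variable {d : ℕ} {φ₁ : ℝ → ℝ} {φ₂ : Esp d → ℝ} {ε : ℝ} {Ω : Set (Esp d)} {T : ℝ}

/-- The points of `Ω_T` at parabolic distance more than half the smoothing scale from its
boundary. -/
def innerSet (Ω : Set (Esp d)) (T ε : ℝ) : Set (Esp d × ℝ) :=
  {x | ε / 2 < Metric.infDist x Ωᶜ} ×ˢ Ioo (ε ^ 2 / 2) (T - ε ^ 2 / 2)

/-- The space-time smoothing kernel, with base point restricted to `innerSet`. -/
def kerIn (φ₁ : ℝ → ℝ) (φ₂ : Esp d → ℝ) (ε : ℝ) (Ω : Set (Esp d)) (T : ℝ)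
    (X Y : Esp d × ℝ) : ℝ≥0∞ :=
  (innerSet Ω T ε).indicator (fun X => kerE φ₁ φ₂ ε (X - Y)) X

lemma measurableSet_innerSet : MeasurableSet (innerSet Ω T ε) :=
  (measurableSet_lt measurable_const (Metric.continuous_infDist_pt _).measurable).prod
    measurableSet_Ioo

lemma measurable_kerIn (h₁ : GoodK1 φ₁) (h₂ : GoodK2 φ₂) :
    Measurable fun P : (Esp d × ℝ) × Esp d × ℝ => kerIn φ₁ φ₂ ε Ω T P.1 P.2 := by
  have h : (fun P : (Esp d × ℝ) × Esp d × ℝ => kerIn φ₁ φ₂ ε Ω T P.1 P.2) =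
      (Prod.fst ⁻¹' innerSet Ω T ε).indicator fun P => kerE φ₁ φ₂ ε (P.1 - P.2) := by
    ext P
    by_cases hP : P.1 ∈ innerSet Ω T ε <;> simp [kerIn, hP]
  rw [h]
  exact ((measurable_kerE h₁ h₂).comp (measurable_fst.sub measurable_snd)).indicator
    (measurable_fst measurableSet_innerSet)

lemma kerIn_le (X Y : Esp d × ℝ) : kerIn φ₁ φ₂ ε Ω T X Y ≤ kerE φ₁ φ₂ ε (X - Y) :=
  indicator_le_self' (f := fun X => kerE φ₁ φ₂ ε (X - Y)) (fun _ _ => zero_le) X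

lemma kerE_ne_zero_iff {X : Esp d × ℝ} :
    kerE φ₁ φ₂ ε X ≠ 0 ↔ kerX φ₂ ε X.1 ≠ 0 ∧ kerT φ₁ ε X.2 ≠ 0 := by
  simp [kerE]

lemma mem_timeSpace_of_mem_innerSet {X Y : Esp d × ℝ} (hX : X ∈ innerSet Ω T ε)
    (hz : ‖X.1 - Y.1‖ < ε / 2) (hs : |X.2 - Y.2| < ε ^ 2 / 2) : Y ∈ timeSpace Ω T := by
  obtain ⟨hx, ht1, ht2⟩ := hX
  rw [abs_lt] at hs
  refine ⟨?_, by linarith [hs.2], by linarith [hs.1]⟩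
  have h := add_smul_mem_of_norm_lt_infDist (U := Ω) (x := X.1) (z := X.1 - Y.1) (hz.trans hx)
    (θ := -1) (by simp)
  simpa using h

lemma mem_of_kerIn_ne_zero (h₁ : GoodK1 φ₁) (h₂ : GoodK2 φ₂) (hε : 0 < ε) {X Y : Esp d × ℝ}
    (h : kerIn φ₁ φ₂ ε Ω T X Y ≠ 0) :
    X ∈ timeSpace Ω T ∧ Y ∈ timeSpace Ω T ∧ ‖X.1 - Y.1‖ < ε / 2 ∧
      ‖X.1 - Y.1‖ < Metric.infDist X.1 Ωᶜ := by
  have hX : X ∈ innerSet Ω T ε := mem_of_indicator_ne_zero h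
  have hk : kerE φ₁ φ₂ ε (X - Y) ≠ 0 := by
    rwa [kerIn, indicator_of_mem hX] at h
  obtain ⟨hkx, hkt⟩ := kerE_ne_zero_iff.1 hk
  have hz := norm_lt_of_kerX_ne_zero h₂ hε hkx
  have hs := abs_lt_of_kerT_ne_zero h₁ hε hkt
  refine ⟨mem_timeSpace_of_mem_innerSet hX ?_ ?_, mem_timeSpace_of_mem_innerSet hX hz hs, hz,
    hz.trans hX.1⟩
  · simpa using hε
  · simpa using pow_pos hε 2

lemma mem_innerSet_of_kerE_ne_zero (h₁ : GoodK1 φ₁) (h₂ : GoodK2 φ₂) (hε : 0 < ε)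
    {X Y : Esp d × ℝ} (hX : X ∈ timeSpace Ω T \ blayer Ω T 1 ε)
    (h : kerE φ₁ φ₂ ε (X - Y) ≠ 0) : Y ∈ innerSet Ω T ε := by
  obtain ⟨hkx, hkt⟩ := kerE_ne_zero_iff.1 h
  have hz := norm_lt_of_kerX_ne_zero h₂ hε hkx
  have hs := abs_lt.1 (abs_lt_of_kerT_ne_zero h₁ hε hkt)
  obtain ⟨⟨hxΩ, ht1, ht2⟩, hl⟩ := hX
  simp only [blayer, one_mul, mem_union, mem_prod, mem_ofPred_eq, mem_Ioo, not_or, not_and,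
    not_lt] at hl
  obtain ⟨⟨hl1, hl2⟩, hl3⟩ := hl
  have hd : ε ≤ Metric.infDist X.1 Ωᶜ := by
    by_contra hc
    exact absurd ht2 (not_lt.2 (hl1 ⟨hxΩ, not_le.1 hc⟩ ht1))
  have ht3 : ε ^ 2 ≤ X.2 := hl2 hxΩ ht1
  have ht4 : X.2 ≤ T - ε ^ 2 := by
    by_contra hc
    exact absurd ht2 (not_lt.2 (hl3 hxΩ (not_le.1 hc)))
  have h5 : Metric.infDist X.1 Ωᶜ ≤ Metric.infDist Y.1 Ωᶜ + dist X.1 Y.1 :=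
    Metric.infDist_le_infDist_add_dist
  rw [dist_eq_norm] at h5
  refine ⟨?_, ?_, ?_⟩
  · change ε / 2 < _
    simp only [Prod.fst_sub] at hz
    linarith
  · simp only [Prod.snd_sub] at hs
    linarith [hs.2]
  · simp only [Prod.snd_sub] at hs
    linarith [hs.1]

lemma measurableSet_timeSpace (hΩ : IsOpen Ω) : MeasurableSet (timeSpace Ω T) :=
  hΩ.measurableSet.prod measurableSet_Ioo

lemma volume_timeSpace_ne_top (hb : Bornology.IsBounded Ω) : volume (timeSpace Ω T) ≠ ∞ := by
  rw [timeSpace, Measure.volume_eq_prod, Measure.prod_prod]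
  exact ENNReal.mul_ne_top hb.measure_lt_top.ne (by simp)

lemma measurableSet_blayer (hΩ : IsOpen Ω) (k : ℝ) : MeasurableSet (blayer Ω T k ε) := by
  have h : MeasurableSet {x ∈ Ω | Metric.infDist x Ωᶜ < k * ε} :=
    hΩ.measurableSet.inter
      (measurableSet_lt (Metric.continuous_infDist_pt _).measurable measurable_const)
  exact ((h.prod measurableSet_Ioo).union (hΩ.measurableSet.prod measurableSet_Ioo)).union
    (hΩ.measurableSet.prod measurableSet_Ioo)

/-- The integrand dominating the smoothed oscillating commutator. -/
def commKer (φ₁ : ℝ → ℝ) (φ₂ : Esp d → ℝ) (ε : ℝ) (Ω : Set (Esp d)) (T : ℝ)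
    (g f h : Esp d → ℝ → Esp d → ℝ → ℝ) (b : Esp d × ℝ → ℝ≥0∞) (X Y Z : Esp d × ℝ) : ℝ≥0∞ :=
  b X * (kerE φ₁ φ₂ ε (X - Y) * ‖f Y.1 Y.2 (ε⁻¹ • X.1) (X.2 / ε ^ 2)‖ₑ) *
    (kerIn φ₁ φ₂ ε Ω T Y Z *
      (‖g Y.1 Y.2 (ε⁻¹ • X.1) (X.2 / ε ^ 2) - g Z.1 Z.2 (ε⁻¹ • X.1) (X.2 / ε ^ 2)‖ₑ *
        ‖h Z.1 Z.2 (ε⁻¹ • X.1) (X.2 / ε ^ 2)‖ₑ))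

lemma Meas4.comp_osc {a : Esp d → ℝ → Esp d → ℝ → ℝ} (ha : Meas4 a) {α : Type*}
    [MeasurableSpace α] {u v : α → Esp d × ℝ} (hu : Measurable u) (hv : Measurable v) (ε : ℝ) :
    Measurable fun P => a (v P).1 (v P).2 (ε⁻¹ • (u P).1) ((u P).2 / ε ^ 2) :=
  Measurable.comp (g := fun w : (Esp d × ℝ) × Esp d × ℝ => a w.1.1 w.1.2 w.2.1 w.2.2)
    (f := fun P => (v P, (ε⁻¹ • (u P).1, (u P).2 / ε ^ 2))) ha (by fun_prop)

lemma measurable_commKer (h₁ : GoodK1 φ₁) (h₂ : GoodK2 φ₂)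
    {g f h : Esp d → ℝ → Esp d → ℝ → ℝ} (hg : Meas4 g) (hf : Meas4 f) (hh : Meas4 h)
    {b : Esp d × ℝ → ℝ≥0∞} (hb : Measurable b) :
    Measurable fun P : (Esp d × ℝ) × (Esp d × ℝ) × Esp d × ℝ =>
      commKer φ₁ φ₂ ε Ω T g f h b P.1 P.2.1 P.2.2 := by
  have e1 : Measurable fun P : (Esp d × ℝ) × (Esp d × ℝ) × Esp d × ℝ => P.1 := measurable_fst
  have e2 : Measurable fun P : (Esp d × ℝ) × (Esp d × ℝ) × Esp d × ℝ => P.2.1 :=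
    measurable_snd.fst
  have e3 : Measurable fun P : (Esp d × ℝ) × (Esp d × ℝ) × Esp d × ℝ => P.2.2 :=
    measurable_snd.snd
  refine ((hb.comp e1).mul (((measurable_kerE h₁ h₂).comp (e1.sub e2)).mul
    (hf.comp_osc e1 e2 ε).enorm)).mul (Measurable.mul ?_ ?_)
  · exact (measurable_kerIn h₁ h₂).comp (e2.prodMk e3)
  · exact ((hg.comp_osc e1 e2 ε).sub (hg.comp_osc e1 e3 ε)).enorm.mul (hh.comp_osc e1 e3 ε).enorm

lemma enorm_smoothed_commutator_le (h₁ : GoodK1 φ₁) (h₂ : GoodK2 φ₂) (hε : 0 < ε)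
    (hΩ : IsOpen Ω) {g f h : Esp d → ℝ → Esp d → ℝ → ℝ} (hg : Meas4 g) (hf : Meas4 f)
    (hh : Meas4 h) {M : ℝ} (hM : ∀ x t y τ, |g x t y τ| ≤ M) {ψ : Esp d × ℝ → ℝ}
    {X : Esp d × ℝ} (hX : X ∈ timeSpace Ω T \ blayer Ω T 1 ε)
    (hi : IntegrableOn (fun Y : Esp d × ℝ => h Y.1 Y.2 (ε⁻¹ • X.1) (X.2 / ε ^ 2))
      (timeSpace Ω T)) :
    ‖osc4 ε (S4 φ₁ φ₂ ε (fun a b c e =>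
        (g a b c e * S4 φ₁ φ₂ ε h a b c e -
          S4 φ₁ φ₂ ε (fun a' b' c' e' => g a' b' c' e' * h a' b' c' e') a b c e) *
          f a b c e)) X.1 X.2 * ψ X‖ₑ ≤
      ∫⁻ Y, ∫⁻ Z, commKer φ₁ φ₂ ε Ω T g f h (fun X => ‖ψ X‖ₑ) X Y Z := by
  have hgh : Meas4 (fun a b c e => g a b c e * h a b c e) := Measurable.mul hg hh
  have hm : Meas4 (fun a b c e => (g a b c e * S4 φ₁ φ₂ ε h a b c e -
      S4 φ₁ φ₂ ε (fun a' b' c' e' => g a' b' c' e' * h a' b' c' e') a b c e) * f a b c e) :=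
    Measurable.mul (Measurable.sub (Measurable.mul hg (hh.s4 h₁ h₂)) (hgh.s4 h₁ h₂)) hf
  rw [enorm_mul, mul_comm]
  refine (mul_le_mul_right (enorm_S4_le hm h₁ h₂ hε X _ _) _).trans
    ((lintegral_const_mul_le _ _).trans (lintegral_mono fun Y => ?_))
  simp only [commKer, enorm_mul]
  by_cases hk : kerE φ₁ φ₂ ε (X - Y) = 0
  · simp [hk]
  · have hY := mem_innerSet_of_kerE_ne_zero h₁ h₂ hε hX hk
    have hc := enorm_commutator_le (X := Y) hg h₁ h₂ hε hM (measurableSet_timeSpace hΩ) hi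
      fun Z hZ => (mem_of_kerIn_ne_zero h₁ h₂ hε
        (by rwa [kerIn, indicator_of_mem hY] : kerIn φ₁ φ₂ ε Ω T Y Z ≠ 0)).2.1
    refine le_trans ?_ (lintegral_const_mul_le _ _)
    have hc' := mul_le_mul_right hc
      (‖ψ X‖ₑ * (kerE φ₁ φ₂ ε (X - Y) * ‖f Y.1 Y.2 (ε⁻¹ • X.1) (X.2 / ε ^ 2)‖ₑ))
    refine le_trans (le_of_eq (by ring)) (hc'.trans (le_of_eq ?_))
    simp only [kerIn, indicator_of_mem hY]

lemma lintegral_smoothed_commutator_le (h₁ : GoodK1 φ₁) (h₂ : GoodK2 φ₂) (hε : 0 < ε)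
    (hΩ : IsOpen Ω) (hΩb : Bornology.IsBounded Ω) {g f h : Esp d → ℝ → Esp d → ℝ → ℝ}
    (hg : Meas4 g) (hf : Meas4 f) (hh : Meas4 h) (hhp : Per4 h) {M : ℝ}
    (hM : ∀ x t y τ, |g x t y τ| ≤ M) {ψ : Esp d × ℝ → ℝ} (hψ : Measurable ψ) {s : ℝ≥0∞}
    (hs : 2 ≤ s) (hH : mixNorm ⊤ ⊤ (timeSpace Ω T) (fun x t => cellNorm s 2 (h x t)) ≠ ∞) :
    mixNorm 1 1 (timeSpace Ω T \ blayer Ω T 1 ε)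
        (fun x t => (‖osc4 ε (S4 φ₁ φ₂ ε (fun a b c e =>
            (g a b c e * S4 φ₁ φ₂ ε h a b c e -
              S4 φ₁ φ₂ ε (fun a' b' c' e' => g a' b' c' e' * h a' b' c' e') a b c e) *
              f a b c e)) x t * ψ (x, t)‖₊ : ℝ≥0∞)) ≤
      ∫⁻ Y, ∫⁻ Z, ∫⁻ X, commKer φ₁ φ₂ ε Ω T g f h (fun X => ‖ψ X‖ₑ) X Y Z := by
  have hJ := measurable_commKer (ε := ε) (Ω := Ω) (T := T) h₁ h₂ hg hf hh hψ.enorm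
  have hgh : Meas4 (fun a b c e => g a b c e * h a b c e) := Measurable.mul hg hh
  have hm : Meas4 (fun a b c e => (g a b c e * S4 φ₁ φ₂ ε h a b c e -
      S4 φ₁ φ₂ ε (fun a' b' c' e' => g a' b' c' e' * h a' b' c' e') a b c e) * f a b c e) :=
    Measurable.mul (Measurable.sub (Measurable.mul hg (hh.s4 h₁ h₂)) (hgh.s4 h₁ h₂)) hf
  have hA : MeasurableSet (timeSpace Ω T \ blayer Ω T 1 ε) :=
    (measurableSet_timeSpace hΩ).diff (measurableSet_blayer hΩ 1)
  rw [mixNorm_eq_indicator one_ne_zero hA]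
  simp_rw [eLp_one]
  have hmF : Measurable fun X : Esp d × ℝ => (timeSpace Ω T \ blayer Ω T 1 ε).indicator
      (fun X => (‖osc4 ε (S4 φ₁ φ₂ ε (fun a b c e =>
            (g a b c e * S4 φ₁ φ₂ ε h a b c e -
              S4 φ₁ φ₂ ε (fun a' b' c' e' => g a' b' c' e' * h a' b' c' e') a b c e) *
              f a b c e)) X.1 X.2 * ψ (X.1, X.2)‖₊ : ℝ≥0∞)) X := by
    refine Measurable.indicator ?_ hA
    exact (((hm.s4 h₁ h₂).comp_osc measurable_id measurable_id ε).mul hψ).enorm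
  rw [← lintegral_prod_symm' _ hmF, ← Measure.volume_eq_prod]
  calc _ ≤ ∫⁻ X, ∫⁻ Y, ∫⁻ Z, commKer φ₁ φ₂ ε Ω T g f h (fun X => ‖ψ X‖ₑ) X Y Z := by
        refine lintegral_mono_ae ?_
        filter_upwards [ae_osc_integrableOn hε hs hh hhp (measurableSet_timeSpace hΩ)
          (volume_timeSpace_ne_top hΩb) hH] with X hX
        by_cases hXA : X ∈ timeSpace Ω T \ blayer Ω T 1 ε
        · rw [indicator_of_mem hXA]
          exact enorm_smoothed_commutator_le h₁ h₂ hε hΩ hg hf hh hM hXA hX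
        · rw [indicator_of_notMem hXA]; exact zero_le
    _ = ∫⁻ Y, ∫⁻ X, ∫⁻ Z, commKer φ₁ φ₂ ε Ω T g f h (fun X => ‖ψ X‖ₑ) X Y Z := by
        refine lintegral_lintegral_swap (Measurable.aemeasurable ?_)
        exact Measurable.lintegral_prod_right'
          (f := fun P : ((Esp d × ℝ) × Esp d × ℝ) × Esp d × ℝ =>
            commKer φ₁ φ₂ ε Ω T g f h (fun X => ‖ψ X‖ₑ) P.1.1 P.1.2 P.2)
          (hJ.comp (measurable_fst.fst.prodMk (measurable_fst.snd.prodMk measurable_snd)))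
    _ = _ := by
        refine lintegral_congr fun Y => lintegral_lintegral_swap (Measurable.aemeasurable ?_)
        exact hJ.comp (f := fun P : (Esp d × ℝ) × Esp d × ℝ => (P.1, Y, P.2))
          (measurable_fst.prodMk (measurable_const.prodMk measurable_snd))

end Reduction

section Increments

variable {d : ℕ} {φ₁ : ℝ → ℝ} {φ₂ : Esp d → ℝ} {ε : ℝ} {Ω : Set (Esp d)} {T : ℝ}
  {g : Esp d → ℝ → Esp d → ℝ → ℝ} {G : Esp d → ℝ → Esp d → ℝ → Esp d}

/-- The norm in `L^∞(Ω; L^∞)` of the time increment `g(t₁) - g(t₂)`. -/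
def incNorm (Ω : Set (Esp d)) (g : Esp d → ℝ → Esp d → ℝ → ℝ) (t₁ t₂ : ℝ) : ℝ≥0∞ :=
  eLp ⊤ (volume.restrict Ω) fun x => cellNorm ⊤ ⊤ fun y τ => g x t₁ y τ - g x t₂ y τ

/-- The cell supremum of the gradient field `G`. -/
def gradNorm (G : Esp d → ℝ → Esp d → ℝ → Esp d) (x : Esp d) (t : ℝ) : ℝ≥0∞ :=
  cellNorm ⊤ ⊤ fun y τ => ‖G x t y τ‖

/-- The mean of `gradNorm G` on the segment from `x` to `x - z` at time `t`. -/
def gradSeg (Ω : Set (Esp d)) (T : ℝ) (G : Esp d → ℝ → Esp d → ℝ → Esp d) (t : ℝ)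
    (x z : Esp d) : ℝ≥0∞ :=
  ∫⁻ θ in Ioc (0 : ℝ) 1,
    (timeSpace Ω T).indicator (fun X => gradNorm G X.1 X.2) (x - θ • z, t)

lemma Meas4.slice_time {a : Esp d → ℝ → Esp d → ℝ → ℝ} (ha : Meas4 a) {α : Type*}
    [MeasurableSpace α] {x : α → Esp d} {t : α → ℝ} (hx : Measurable x) (ht : Measurable t) :
    Measurable fun P : α × Esp d × ℝ => a (x P.1) (t P.1) P.2.1 P.2.2 :=
  Measurable.comp (g := fun w : (Esp d × ℝ) × Esp d × ℝ => a w.1.1 w.1.2 w.2.1 w.2.2)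
    (f := fun P : α × Esp d × ℝ => ((x P.1, t P.1), P.2)) ha (by fun_prop)

lemma measurable_incNorm (hg : Meas4 g) :
    Measurable fun P : ℝ × ℝ => incNorm Ω g P.1 P.2 := by
  refine measurable_eLp_right (f := fun (P : ℝ × ℝ) x =>
    cellNorm ⊤ ⊤ fun y τ => g x P.1 y τ - g x P.2 y τ) ?_
  refine measurable_cellNorm (a := fun (P : (ℝ × ℝ) × Esp d) y τ =>
    g P.2 P.1.1 y τ - g P.2 P.1.2 y τ) ?_
  exact (hg.slice_time measurable_snd measurable_fst.fst).sub
    (hg.slice_time measurable_snd measurable_fst.snd)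

lemma measurable_gradNorm
    (hG : Measurable fun w : (Esp d × ℝ) × Esp d × ℝ => G w.1.1 w.1.2 w.2.1 w.2.2) :
    Measurable fun X : Esp d × ℝ => gradNorm G X.1 X.2 :=
  measurable_cellNorm (a := fun (X : Esp d × ℝ) y τ => ‖G X.1 X.2 y τ‖) hG.norm

lemma measurable_gradSeg (hΩ : IsOpen Ω)
    (hG : Measurable fun w : (Esp d × ℝ) × Esp d × ℝ => G w.1.1 w.1.2 w.2.1 w.2.2) :
    Measurable fun P : ℝ × Esp d × Esp d => gradSeg Ω T G P.1 P.2.1 P.2.2 :=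
  measurable_setLIntegral_segment
    (W := fun t x => (timeSpace Ω T).indicator (fun X => gradNorm G X.1 X.2) (x, t))
    (((measurable_gradNorm hG).indicator (measurableSet_timeSpace hΩ)).comp measurable_swap)

lemma ae_osc_time_increment_le (hε : 0 < ε) (hΩ : IsOpen Ω) (hg : Meas4 g) (hgp : Per4 g) (t₁ : ℝ) :
    ∀ᵐ Z : Esp d × ℝ, Z ∈ timeSpace Ω T → ∀ᵐ X : Esp d × ℝ,
      ‖g Z.1 t₁ (ε⁻¹ • X.1) (X.2 / ε ^ 2) - g Z.1 Z.2 (ε⁻¹ • X.1) (X.2 / ε ^ 2)‖ₑ ≤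
        incNorm Ω g t₁ Z.2 := by
  have hm : MeasurableSet {Z : Esp d × ℝ | ∀ᵐ X : Esp d × ℝ,
      ‖g Z.1 t₁ (ε⁻¹ • X.1) (X.2 / ε ^ 2) - g Z.1 Z.2 (ε⁻¹ • X.1) (X.2 / ε ^ 2)‖ₑ ≤
        incNorm Ω g t₁ Z.2} := by
    refine measurableSet_ae_right (p := fun (Z X : Esp d × ℝ) =>
      ‖g Z.1 t₁ (ε⁻¹ • X.1) (X.2 / ε ^ 2) - g Z.1 Z.2 (ε⁻¹ • X.1) (X.2 / ε ^ 2)‖ₑ ≤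
        incNorm Ω g t₁ Z.2) (measurableSet_le (Measurable.enorm (Measurable.sub ?_ ?_)) ?_)
    · exact hg.comp_osc (v := fun P : (Esp d × ℝ) × Esp d × ℝ => (P.1.1, t₁)) measurable_snd
        (by fun_prop) ε
    · exact hg.comp_osc measurable_snd measurable_fst ε
    · exact (measurable_incNorm hg).comp (f := fun P : (Esp d × ℝ) × Esp d × ℝ => (t₁, P.1.2))
        (by fun_prop)
  refine ae_prod_of_ae_ae_symm (p := fun x t => (x, t) ∈ timeSpace Ω T → ∀ᵐ X : Esp d × ℝ,
      ‖g x t₁ (ε⁻¹ • X.1) (X.2 / ε ^ 2) - g x t (ε⁻¹ • X.1) (X.2 / ε ^ 2)‖ₑ ≤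
        incNorm Ω g t₁ t) ((measurableSet_timeSpace hΩ).imp hm)
    (Filter.Eventually.of_forall fun t => ?_)
  have h := ENNReal.ae_le_essSup (μ := volume.restrict Ω)
    (fun x => cellNorm ⊤ ⊤ fun y τ => g x t₁ y τ - g x t y τ)
  rw [ae_restrict_iff' hΩ.measurableSet] at h
  filter_upwards [h] with x hx hxt
  have h2 := ae_osc_enorm_le_cellNorm_top (a := fun y τ => g x t₁ y τ - g x t y τ) hε
    (by
      have h3 := fun t => hg.slice_time (α := Unit) (x := fun _ => x) (t := fun _ => t)
        measurable_const measurable_const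
      exact ((h3 t₁).sub (h3 t)).comp (f := fun p : Esp d × ℝ => ((), p)) (by fun_prop))
    fun y τ => ⟨fun i => by rw [(hgp x t₁ y τ).1, (hgp x t y τ).1],
      by rw [(hgp x t₁ y τ).2, (hgp x t y τ).2]⟩
  filter_upwards [h2] with X hX
  refine hX.trans ((hx hxt.1).trans (le_of_eq ?_))
  rw [incNorm, eLp_top]

lemma ae_lintegral_gradNorm_ne_top (hd : 1 ≤ d) (hb : Bornology.IsBounded Ω)
    (hS : mixNorm ⊤ (d : ℝ≥0∞) (timeSpace Ω T) (gradNorm G) ≠ ∞) :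
    ∀ᵐ t ∂volume.restrict (Ioo 0 T), ∫⁻ x in Ω, gradNorm G x t ≠ ∞ := by
  rw [ae_restrict_iff' measurableSet_Ioo]
  have h1 := ENNReal.ae_le_essSup (μ := (volume : Measure ℝ)) fun t =>
    eLp (d : ℝ≥0∞) (volume.restrict {x | (x, t) ∈ timeSpace Ω T}) fun x => gradNorm G x t
  rw [mixNorm, eLp_top] at hS
  filter_upwards [h1] with t ht htT
  have hs : {x | (x, t) ∈ timeSpace Ω T} = Ω := by
    ext x; simp [timeSpace, htT.1, htT.2]
  have h2 := ne_top_of_le_ne_top hS ht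
  have hd' : (1 : ℝ) ≤ d := by exact_mod_cast hd
  rw [hs, eLp_of_ne_top (ENNReal.natCast_ne_top d), ENNReal.toReal_natCast] at h2
  have h3 : ∫⁻ x in Ω, gradNorm G x t ^ (d : ℝ) ≠ ∞ := fun h => by
    rw [h, ENNReal.top_rpow_of_pos (by positivity)] at h2
    exact h2 rfl
  have h4 : ∫⁻ x in Ω, (1 + gradNorm G x t ^ (d : ℝ)) ≠ ∞ := by
    rw [lintegral_add_left measurable_const, setLIntegral_one]
    exact ENNReal.add_ne_top.2 ⟨hb.measure_lt_top.ne, h3⟩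
  refine ne_top_of_le_ne_top h4 (lintegral_mono fun x => ?_)
  rcases le_total (gradNorm G x t) 1 with h | h
  · exact h.trans le_self_add
  · calc gradNorm G x t = gradNorm G x t ^ (1 : ℝ) := (ENNReal.rpow_one _).symm
      _ ≤ gradNorm G x t ^ (d : ℝ) := ENNReal.rpow_le_rpow_of_exponent_le h hd'
      _ ≤ _ := le_add_self

lemma ae_osc_space_increment_le (hd : 1 ≤ d) (hε : 0 < ε) (hΩ : IsOpen Ω)
    (hb : Bornology.IsBounded Ω) (hg : Meas4 g) (hgp : Per4 g) {M : ℝ}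
    (hM : ∀ x t y τ, |g x t y τ| ≤ M)
    (hG : Measurable fun w : (Esp d × ℝ) × Esp d × ℝ => G w.1.1 w.1.2 w.2.1 w.2.2)
    (hw : ∀ᵐ w : ℝ × Esp d × ℝ ∂((volume.restrict (Ioo (0:ℝ) T)).prod volume),
      IsWeakGradOn Ω (fun x => g x w.1 w.2.1 w.2.2) (fun x => G x w.1 w.2.1 w.2.2))
    (hS : mixNorm ⊤ (d : ℝ≥0∞) (timeSpace Ω T) (gradNorm G) ≠ ∞) :
    ∀ᵐ Y : Esp d × ℝ, Y ∈ timeSpace Ω T → ∀ᵐ Z : Esp d × ℝ, ∀ᵐ X : Esp d × ℝ,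
      ‖Y.1 - Z.1‖ < Metric.infDist Y.1 Ωᶜ →
      ‖g Y.1 Y.2 (ε⁻¹ • X.1) (X.2 / ε ^ 2) - g Z.1 Y.2 (ε⁻¹ • X.1) (X.2 / ε ^ 2)‖ₑ ≤
        ‖Y.1 - Z.1‖ₑ * gradSeg Ω T G Y.2 Y.1 (Y.1 - Z.1) := by
  let p : Esp d → ℝ → Esp d → Esp d × ℝ → Prop := fun x t z X =>
    ‖z‖ < Metric.infDist x Ωᶜ →
      ‖g x t (ε⁻¹ • X.1) (X.2 / ε ^ 2) - g (x - z) t (ε⁻¹ • X.1) (X.2 / ε ^ 2)‖ₑ ≤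
        ‖z‖ₑ * gradSeg Ω T G t x z
  have hm1 : MeasurableSet {Q : ((Esp d × ℝ) × Esp d) × Esp d × ℝ |
      p Q.1.1.1 Q.1.1.2 Q.1.2 Q.2} := by
    refine (measurableSet_lt (by fun_prop)
      ((Metric.continuous_infDist_pt _).measurable.comp (by fun_prop))).imp
      (measurableSet_le (Measurable.enorm (Measurable.sub ?_ ?_)) (Measurable.mul ?_ ?_))
    · exact hg.comp_osc measurable_snd measurable_fst.fst ε
    · exact hg.comp_osc (v := fun Q : ((Esp d × ℝ) × Esp d) × Esp d × ℝ =>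
        (Q.1.1.1 - Q.1.2, Q.1.1.2)) measurable_snd (by fun_prop) ε
    · exact measurable_fst.snd.enorm
    · exact (measurable_gradSeg hΩ hG).comp (f := fun Q : ((Esp d × ℝ) × Esp d) × Esp d × ℝ =>
        (Q.1.1.2, Q.1.1.1, Q.1.2)) (by fun_prop)
  have hm2 : MeasurableSet {Q : (Esp d × ℝ) × Esp d | ∀ᵐ X : Esp d × ℝ, p Q.1.1 Q.1.2 Q.2 X} :=
    measurableSet_ae_right (p := fun (Q : (Esp d × ℝ) × Esp d) X => p Q.1.1 Q.1.2 Q.2 X) hm1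
  have hm3 : MeasurableSet {Y : Esp d × ℝ | ∀ᵐ z : Esp d, ∀ᵐ X : Esp d × ℝ, p Y.1 Y.2 z X} :=
    measurableSet_ae_right (p := fun (Y : Esp d × ℝ) z => ∀ᵐ X : Esp d × ℝ, p Y.1 Y.2 z X) hm2
  have key : ∀ᵐ Y : Esp d × ℝ, Y ∈ timeSpace Ω T → ∀ᵐ z, ∀ᵐ X : Esp d × ℝ, p Y.1 Y.2 z X := by
    refine ae_prod_of_ae_ae_symm (p := fun x t => (x, t) ∈ timeSpace Ω T →
      ∀ᵐ z, ∀ᵐ X : Esp d × ℝ, p x t z X) ((measurableSet_timeSpace hΩ).imp hm3) ?_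
    have hw' := Measure.ae_ae_of_ae_prod hw
    have hS' := ae_lintegral_gradNorm_ne_top hd hb hS
    rw [ae_restrict_iff' measurableSet_Ioo] at hw' hS'
    filter_upwards [hw', hS'] with t hwt hSt
    by_cases ht : t ∈ Ioo 0 T
    swap
    · exact Filter.Eventually.of_forall fun x hx => absurd hx.2 ht
    have hwt2 := Measure.measurePreserving_swap.quasiMeasurePreserving.ae
      (p := fun w : Esp d × ℝ => IsWeakGradOn Ω (fun x => g x t w.1 w.2) fun x => G x t w.1 w.2)
      (μa := (volume : Measure ℝ).prod (volume : Measure (Esp d))) (hwt ht)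
    have hsl := ae_ae_osc_enorm_sub_le (u := fun x y τ => g x t y τ) (v := fun x y τ => G x t y τ)
      hε hΩ.measurableSet (hg.slice_time measurable_id measurable_const)
      (hG.comp (f := fun P : Esp d × Esp d × ℝ => ((P.1, t), P.2)) (by fun_prop))
      (fun x y τ => hgp x t y τ) (fun x y τ => hM x t y τ)
      (Measure.ae_ae_of_ae_prod hwt2) (hSt ht)
    have hind : ∀ x, (timeSpace Ω T).indicator (fun X => gradNorm G X.1 X.2) (x, t) =
        Ω.indicator (fun x => gradNorm G x t) x := fun x => by
      by_cases hx : x ∈ Ω <;> simp [timeSpace, hx, ht.1, ht.2]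
    have hzx : ∀ᵐ z : Esp d, ∀ᵐ x : Esp d, ∀ᵐ X : Esp d × ℝ, p x t z X := by
      refine Filter.Eventually.of_forall fun z => ?_
      filter_upwards [hsl z] with x hx
      filter_upwards [hx] with X hX h
      simp only [gradSeg, hind]
      exact hX h
    have hcomm := (Measure.ae_ae_comm (μ := (volume : Measure (Esp d)))
      (ν := (volume : Measure (Esp d))) (p := fun x z => ∀ᵐ X : Esp d × ℝ, p x t z X)
      (hm2.preimage (f := fun Q : Esp d × Esp d => ((Q.1, t), Q.2)) (by fun_prop))).2 hzx
    filter_upwards [hcomm] with x hx _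
    exact hx
  filter_upwards [key] with Y hY hYT
  have h1 := (quasiMeasurePreserving_sub_left (volume : Measure (Esp d)) Y.1).ae (hY hYT)
  have h2 := (Measure.quasiMeasurePreserving_fst (μ := (volume : Measure (Esp d)))
    (ν := (volume : Measure ℝ))).ae h1
  filter_upwards [h2] with Z hZ
  filter_upwards [hZ] with X hX h
  have h3 := hX h
  rwa [_root_.sub_sub_cancel] at h3

end Increments

section Estimate

variable {d : ℕ} {φ₁ : ℝ → ℝ} {φ₂ : Esp d → ℝ} {ε : ℝ} {Ω : Set (Esp d)} {T : ℝ}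
  {g f h : Esp d → ℝ → Esp d → ℝ → ℝ} {G : Esp d → ℝ → Esp d → ℝ → Esp d}

/-- The quadratic mean of `b` against the smoothing kernel centred at `Y`. -/
def sqMean (φ₁ : ℝ → ℝ) (φ₂ : Esp d → ℝ) (ε : ℝ) (b : Esp d × ℝ → ℝ≥0∞) (Y : Esp d × ℝ) : ℝ≥0∞ :=
  (∫⁻ X, kerE φ₁ φ₂ ε (X - Y) * b X ^ 2) ^ (1 / 2 : ℝ)

lemma measurable_sqMean (h₁ : GoodK1 φ₁) (h₂ : GoodK2 φ₂) {b : Esp d × ℝ → ℝ≥0∞}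
    (hb : Measurable b) : Measurable (sqMean φ₁ φ₂ ε b) := by
  refine Measurable.pow_const ?_ _
  exact Measurable.lintegral_prod_right'
    (f := fun P : (Esp d × ℝ) × Esp d × ℝ => kerE φ₁ φ₂ ε (P.2 - P.1) * b P.2 ^ 2)
    (((measurable_kerE h₁ h₂).comp (measurable_snd.sub measurable_fst)).mul
      ((hb.comp measurable_snd).pow_const 2))

lemma lintegral_commKer_le (h₁ : GoodK1 φ₁) (h₂ : GoodK2 φ₂) (hε : 0 < ε) {M₁ M₂ : ℝ}
    (hM₁ : ∀ y, φ₁ y ≤ M₁) (hM₂ : ∀ y, φ₂ y ≤ M₂) (hf : Meas4 f) (hfp : Per4 f) (hh : Meas4 h)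
    (hhp : Per4 h) {b : Esp d × ℝ → ℝ≥0∞} (hb : Measurable b) {s H : ℝ≥0∞} (hs : 2 ≤ s)
    {Y Z : Esp d × ℝ} (hH : Z ∈ timeSpace Ω T → cellNorm s 2 (h Z.1 Z.2) ≤ H) {K : ℝ≥0∞}
    (hK : Y ∈ timeSpace Ω T → Z ∈ timeSpace Ω T → ‖Y.1 - Z.1‖ < ε / 2 →
      ‖Y.1 - Z.1‖ < Metric.infDist Y.1 Ωᶜ → ∀ᵐ X : Esp d × ℝ,
      ‖g Y.1 Y.2 (ε⁻¹ • X.1) (X.2 / ε ^ 2) - g Z.1 Z.2 (ε⁻¹ • X.1) (X.2 / ε ^ 2)‖ₑ ≤ K) :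
    ∫⁻ X, commKer φ₁ φ₂ ε Ω T g f h b X Y Z ≤
      (ENNReal.ofReal M₁ * ENNReal.ofReal M₂) ^ (1 / 2 : ℝ) * H *
        ((timeSpace Ω T).indicator (fun X => cellNorm ⊤ ⊤ (f X.1 X.2)) Y * sqMean φ₁ φ₂ ε b Y *
          (kerIn φ₁ φ₂ ε Ω T Y Z * K)) := by
  by_cases h0 : kerIn φ₁ φ₂ ε Ω T Y Z = 0
  · simp [commKer, h0]
  obtain ⟨hY, hZ, hd1, hd2⟩ := mem_of_kerIn_ne_zero h₁ h₂ hε h0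
  have hsl : ∀ {a : Esp d → ℝ → Esp d → ℝ → ℝ}, Meas4 a → ∀ W : Esp d × ℝ,
      Measurable fun p : Esp d × ℝ => a W.1 W.2 p.1 p.2 := fun ha W =>
    Measurable.comp (f := fun p : Esp d × ℝ => (W, p)) ha (by fun_prop)
  set F := cellNorm ⊤ ⊤ (f Y.1 Y.2) with hF
  have hae : ∀ᵐ X : Esp d × ℝ, commKer φ₁ φ₂ ε Ω T g f h b X Y Z ≤
      F * (kerIn φ₁ φ₂ ε Ω T Y Z * K) *
        (kerE φ₁ φ₂ ε (X - Y) * (b X * ‖h Z.1 Z.2 (ε⁻¹ • X.1) (X.2 / ε ^ 2)‖ₑ)) := by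
    filter_upwards [hK hY hZ hd1 hd2, ae_osc_enorm_le_cellNorm_top hε (hsl hf Y)
      (hfp Y.1 Y.2)] with X hX hX2
    calc commKer φ₁ φ₂ ε Ω T g f h b X Y Z ≤ b X * (kerE φ₁ φ₂ ε (X - Y) * F) *
          (kerIn φ₁ φ₂ ε Ω T Y Z * (K * ‖h Z.1 Z.2 (ε⁻¹ • X.1) (X.2 / ε ^ 2)‖ₑ)) := by
          unfold commKer; gcongr
      _ = _ := by ring
  refine (lintegral_mono_ae hae).trans ?_
  have hm : Measurable fun X : Esp d × ℝ => kerE φ₁ φ₂ ε (X - Y) *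
      (b X * ‖h Z.1 Z.2 (ε⁻¹ • X.1) (X.2 / ε ^ 2)‖ₑ) :=
    ((measurable_kerE h₁ h₂).comp (measurable_id.sub_const Y)).mul
      (hb.mul (hh.comp_osc measurable_id measurable_const ε).enorm)
  rw [lintegral_const_mul _ hm, indicator_of_mem hY]
  calc _ ≤ F * (kerIn φ₁ φ₂ ε Ω T Y Z * K) * (sqMean φ₁ φ₂ ε b Y *
        ((ENNReal.ofReal M₁ * ENNReal.ofReal M₂) ^ (1 / 2 : ℝ) * H)) := by
        refine mul_le_mul_right ((lintegral_kerE_mul_osc_le h₁ h₂ hε hM₁ hM₂ hs (hsl hh Z)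
          (hhp Z.1 Z.2) hb Y).trans ?_) _
        exact mul_le_mul_right (mul_le_mul_right (hH hZ) _) _
    _ = _ := by ring

/-- Averaged time increments of `g` at the smoothing scale. -/
def timeInc (φ₁ : ℝ → ℝ) (ε : ℝ) (Ω : Set (Esp d)) (T : ℝ) (g : Esp d → ℝ → Esp d → ℝ → ℝ)
    (t : ℝ) : ℝ≥0∞ :=
  (Ioo 0 T).indicator (fun t => ∫⁻ r in Ioo 0 T, kerT φ₁ ε (t - r) * incNorm Ω g t r) t

/-- Averaged segment means of the gradient at the smoothing scale. -/
def gradMean (φ₂ : Esp d → ℝ) (ε : ℝ) (Ω : Set (Esp d)) (T : ℝ)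
    (G : Esp d → ℝ → Esp d → ℝ → Esp d) (X : Esp d × ℝ) : ℝ≥0∞ :=
  ∫⁻ z, kerX φ₂ ε z * gradSeg Ω T G X.2 X.1 z

lemma measurable_timeInc (h₁ : GoodK1 φ₁) (hg : Meas4 g) : Measurable (timeInc φ₁ ε Ω T g) := by
  refine Measurable.indicator ?_ measurableSet_Ioo
  exact Measurable.lintegral_prod_right'
    (f := fun P : ℝ × ℝ => kerT φ₁ ε (P.1 - P.2) * incNorm Ω g P.1 P.2)
    (((measurable_kerT h₁).comp (measurable_fst.sub measurable_snd)).mul (measurable_incNorm hg))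

lemma measurable_gradMean (h₂ : GoodK2 φ₂) (hΩ : IsOpen Ω)
    (hG : Measurable fun w : (Esp d × ℝ) × Esp d × ℝ => G w.1.1 w.1.2 w.2.1 w.2.2) :
    Measurable (gradMean φ₂ ε Ω T G) :=
  Measurable.lintegral_prod_right'
    (f := fun P : (Esp d × ℝ) × Esp d => kerX φ₂ ε P.2 * gradSeg Ω T G P.1.2 P.1.1 P.2)
    (((measurable_kerX h₂).comp measurable_snd).mul ((measurable_gradSeg hΩ hG).comp
      (measurable_fst.snd.prodMk (measurable_fst.fst.prodMk measurable_snd))))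

lemma lintegral_kerIn_incNorm_le (h₁ : GoodK1 φ₁) (h₂ : GoodK2 φ₂) (hε : 0 < ε) (hg : Meas4 g)
    (Y : Esp d × ℝ) :
    ∫⁻ Z, kerIn φ₁ φ₂ ε Ω T Y Z * incNorm Ω g Y.2 Z.2 ≤ timeInc φ₁ ε Ω T g Y.2 := by
  by_cases hY : Y.2 ∈ Ioo 0 T
  swap
  · have h0 : ∀ Z, kerIn φ₁ φ₂ ε Ω T Y Z = 0 := fun Z => by
      by_contra hc
      exact hY (mem_of_kerIn_ne_zero h₁ h₂ hε hc).1.2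
    simp [h0]
  have hk : Measurable fun r => kerT φ₁ ε (Y.2 - r) :=
    (measurable_kerT h₁).comp (measurable_const.sub measurable_id)
  have hN : Measurable fun r => incNorm Ω g Y.2 r :=
    (measurable_incNorm hg).comp (f := fun r => (Y.2, r)) (by fun_prop)
  have hkx : Measurable fun x => kerX φ₂ ε (Y.1 - x) :=
    (measurable_kerX h₂).comp (measurable_const.sub measurable_id)
  have hr : Measurable ((Ioo 0 T).indicator fun r => kerT φ₁ ε (Y.2 - r) * incNorm Ω g Y.2 r) :=
    (hk.mul hN).indicator measurableSet_Ioo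
  calc _ ≤ ∫⁻ Z : Esp d × ℝ, kerX φ₂ ε (Y.1 - Z.1) * (Ioo 0 T).indicator
        (fun r => kerT φ₁ ε (Y.2 - r) * incNorm Ω g Y.2 r) Z.2 := by
        refine lintegral_mono fun Z => ?_
        by_cases hZ : kerIn φ₁ φ₂ ε Ω T Y Z = 0
        · simp [hZ]
        · rw [indicator_of_mem (mem_of_kerIn_ne_zero h₁ h₂ hε hZ).2.1.2, ← mul_assoc]
          exact mul_le_mul_left (kerIn_le Y Z) _
    _ = _ := by
        rw [Measure.volume_eq_prod, lintegral_prod_mul hkx.aemeasurable hr.aemeasurable,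
          lintegral_sub_left_eq_self (kerX φ₂ ε), lintegral_kerX h₂ hε, one_mul,
          lintegral_indicator measurableSet_Ioo, timeInc, indicator_of_mem hY]

lemma lintegral_kerIn_gradSeg_le (h₁ : GoodK1 φ₁) (h₂ : GoodK2 φ₂) (hε : 0 < ε) (hΩ : IsOpen Ω)
    (hG : Measurable fun w : (Esp d × ℝ) × Esp d × ℝ => G w.1.1 w.1.2 w.2.1 w.2.2)
    (Y : Esp d × ℝ) :
    ∫⁻ Z, kerIn φ₁ φ₂ ε Ω T Y Z * gradSeg Ω T G Y.2 Y.1 (Y.1 - Z.1) ≤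
      gradMean φ₂ ε Ω T G Y := by
  have hL : Measurable fun z => kerX φ₂ ε z * gradSeg Ω T G Y.2 Y.1 z :=
    (measurable_kerX h₂).mul ((measurable_gradSeg hΩ hG).comp
      (measurable_const.prodMk (measurable_const.prodMk measurable_id)))
  have hLx : Measurable fun x => kerX φ₂ ε (Y.1 - x) * gradSeg Ω T G Y.2 Y.1 (Y.1 - x) :=
    hL.comp (measurable_const.sub measurable_id)
  have hk : Measurable fun r => kerT φ₁ ε (Y.2 - r) :=
    (measurable_kerT h₁).comp (measurable_const.sub measurable_id)
  calc _ ≤ ∫⁻ Z : Esp d × ℝ, (kerX φ₂ ε (Y.1 - Z.1) * gradSeg Ω T G Y.2 Y.1 (Y.1 - Z.1)) *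
        kerT φ₁ ε (Y.2 - Z.2) := by
        refine lintegral_mono fun Z => (mul_le_mul_left (kerIn_le Y Z) _).trans (le_of_eq ?_)
        simp only [kerE, Prod.fst_sub, Prod.snd_sub]
        ring
    _ = _ := by
        rw [Measure.volume_eq_prod, lintegral_prod_mul hLx.aemeasurable hk.aemeasurable,
          lintegral_sub_left_eq_self (kerT φ₁ ε), lintegral_kerT h₁ hε, mul_one,
          lintegral_sub_left_eq_self (fun z => kerX φ₂ ε z * gradSeg Ω T G Y.2 Y.1 z)]
        rfl

lemma lintegral_lintegral_commKer_le (hd : 1 ≤ d) (h₁ : GoodK1 φ₁) (h₂ : GoodK2 φ₂) (hε : 0 < ε)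
    {M₁ M₂ : ℝ} (hM₁ : ∀ y, φ₁ y ≤ M₁) (hM₂ : ∀ y, φ₂ y ≤ M₂) (hΩ : IsOpen Ω)
    (hΩb : Bornology.IsBounded Ω) (hg : Meas4 g) (hgp : Per4 g) {M : ℝ}
    (hM : ∀ x t y τ, |g x t y τ| ≤ M)
    (hG : Measurable fun w : (Esp d × ℝ) × Esp d × ℝ => G w.1.1 w.1.2 w.2.1 w.2.2)
    (hw : ∀ᵐ w : ℝ × Esp d × ℝ ∂((volume.restrict (Ioo (0:ℝ) T)).prod volume),
      IsWeakGradOn Ω (fun x => g x w.1 w.2.1 w.2.2) (fun x => G x w.1 w.2.1 w.2.2))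
    (hS : mixNorm ⊤ (d : ℝ≥0∞) (timeSpace Ω T) (gradNorm G) ≠ ∞)
    (hf : Meas4 f) (hfp : Per4 f) (hh : Meas4 h) (hhp : Per4 h) {b : Esp d × ℝ → ℝ≥0∞}
    (hb : Measurable b) {s : ℝ≥0∞} (hs : 2 ≤ s) :
    ∫⁻ Y, ∫⁻ Z, ∫⁻ X, commKer φ₁ φ₂ ε Ω T g f h b X Y Z ≤
      (ENNReal.ofReal M₁ * ENNReal.ofReal M₂) ^ (1 / 2 : ℝ) *
          mixNorm ⊤ ⊤ (timeSpace Ω T) (fun x t => cellNorm s 2 (h x t)) *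
        ∫⁻ Y, (timeSpace Ω T).indicator (fun X => cellNorm ⊤ ⊤ (f X.1 X.2)) Y *
          sqMean φ₁ φ₂ ε b Y *
          (timeInc φ₁ ε Ω T g Y.2 + ENNReal.ofReal ε * gradMean φ₂ ε Ω T G Y) := by
  set H := mixNorm ⊤ ⊤ (timeSpace Ω T) (fun x t => cellNorm s 2 (h x t))
  set C₀ := (ENNReal.ofReal M₁ * ENNReal.ofReal M₂) ^ (1 / 2 : ℝ)
  have hhm : Measurable fun X : Esp d × ℝ => cellNorm s 2 (h X.1 X.2) :=
    measurable_cellNorm (a := fun X : Esp d × ℝ => h X.1 X.2) hh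
  have hfm : Measurable ((timeSpace Ω T).indicator fun X => cellNorm ⊤ ⊤ (f X.1 X.2)) :=
    (measurable_cellNorm (a := fun X : Esp d × ℝ => f X.1 X.2) hf).indicator
      (measurableSet_timeSpace hΩ)
  have hHae := ae_le_mixNorm_top (F := fun x t => cellNorm s 2 (h x t))
    (measurableSet_timeSpace (T := T) hΩ) hhm
  have hRm : Measurable fun Y => (timeSpace Ω T).indicator (fun X => cellNorm ⊤ ⊤ (f X.1 X.2)) Y *
      sqMean φ₁ φ₂ ε b Y *
      (timeInc φ₁ ε Ω T g Y.2 + ENNReal.ofReal ε * gradMean φ₂ ε Ω T G Y) :=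
    (hfm.mul (measurable_sqMean h₁ h₂ hb)).mul
      (((measurable_timeInc h₁ hg).comp measurable_snd).add
        ((measurable_gradMean h₂ hΩ hG).const_mul _))
  rw [← lintegral_const_mul _ hRm]
  refine lintegral_mono_ae ?_
  filter_upwards [ae_osc_space_increment_le hd hε hΩ hΩb hg hgp hM hG hw hS] with Y hY
  have hin : ∀ᵐ Z : Esp d × ℝ, ∫⁻ X, commKer φ₁ φ₂ ε Ω T g f h b X Y Z ≤ C₀ * H *
      ((timeSpace Ω T).indicator (fun X => cellNorm ⊤ ⊤ (f X.1 X.2)) Y * sqMean φ₁ φ₂ ε b Y) *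
        (kerIn φ₁ φ₂ ε Ω T Y Z * (incNorm Ω g Y.2 Z.2 +
          ENNReal.ofReal ε * gradSeg Ω T G Y.2 Y.1 (Y.1 - Z.1))) := by
    by_cases hYT : Y ∈ timeSpace Ω T
    swap
    · refine Filter.Eventually.of_forall fun Z => ?_
      have h0 : kerIn φ₁ φ₂ ε Ω T Y Z = 0 := by
        by_contra hc
        exact hYT (mem_of_kerIn_ne_zero h₁ h₂ hε hc).1
      simp [commKer, h0]
    filter_upwards [hY hYT, ae_osc_time_increment_le hε hΩ hg hgp Y.2 (T := T), hHae]
      with Z hZ1 hZ2 hZ3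
    refine (lintegral_commKer_le h₁ h₂ hε hM₁ hM₂ hf hfp hh hhp hb hs hZ3
      (K := incNorm Ω g Y.2 Z.2 + ENNReal.ofReal ε * gradSeg Ω T G Y.2 Y.1 (Y.1 - Z.1))
      fun _ hZT hd1 hd2 => ?_).trans (le_of_eq (by ring))
    filter_upwards [hZ1, hZ2 hZT] with X hX1 hX2
    have hε' : ‖Y.1 - Z.1‖ₑ ≤ ENNReal.ofReal ε := by
      rw [← ofReal_norm]
      exact ENNReal.ofReal_le_ofReal (by linarith)
    calc _ = ‖(g Z.1 Y.2 (ε⁻¹ • X.1) (X.2 / ε ^ 2) - g Z.1 Z.2 (ε⁻¹ • X.1) (X.2 / ε ^ 2)) +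
          (g Y.1 Y.2 (ε⁻¹ • X.1) (X.2 / ε ^ 2) - g Z.1 Y.2 (ε⁻¹ • X.1) (X.2 / ε ^ 2))‖ₑ := by
          congr 1; ring
      _ ≤ _ := (enorm_add_le _ _).trans
          (add_le_add hX2 ((hX1 hd2).trans (mul_le_mul_left hε' _)))
  have hkm : Measurable fun Z => kerIn φ₁ φ₂ ε Ω T Y Z :=
    (measurable_kerIn h₁ h₂).comp (f := fun Z : Esp d × ℝ => (Y, Z)) (by fun_prop)
  have hNm : Measurable fun Z : Esp d × ℝ => incNorm Ω g Y.2 Z.2 :=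
    (measurable_incNorm hg).comp (f := fun Z : Esp d × ℝ => (Y.2, Z.2)) (by fun_prop)
  have hLm : Measurable fun Z : Esp d × ℝ => gradSeg Ω T G Y.2 Y.1 (Y.1 - Z.1) :=
    (measurable_gradSeg hΩ hG).comp (f := fun Z : Esp d × ℝ => (Y.2, Y.1, Y.1 - Z.1))
      (by fun_prop)
  have hkN : Measurable fun Z => kerIn φ₁ φ₂ ε Ω T Y Z * incNorm Ω g Y.2 Z.2 := hkm.mul hNm
  have hkL : Measurable fun Z => kerIn φ₁ φ₂ ε Ω T Y Z * gradSeg Ω T G Y.2 Y.1 (Y.1 - Z.1) :=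
    hkm.mul hLm
  have hsum : ∀ Z : Esp d × ℝ, kerIn φ₁ φ₂ ε Ω T Y Z * (incNorm Ω g Y.2 Z.2 +
      ENNReal.ofReal ε * gradSeg Ω T G Y.2 Y.1 (Y.1 - Z.1)) =
      kerIn φ₁ φ₂ ε Ω T Y Z * incNorm Ω g Y.2 Z.2 +
        ENNReal.ofReal ε * (kerIn φ₁ φ₂ ε Ω T Y Z * gradSeg Ω T G Y.2 Y.1 (Y.1 - Z.1)) :=
    fun Z => by ring
  have hks : Measurable fun Z => kerIn φ₁ φ₂ ε Ω T Y Z * incNorm Ω g Y.2 Z.2 +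
      ENNReal.ofReal ε * (kerIn φ₁ φ₂ ε Ω T Y Z * gradSeg Ω T G Y.2 Y.1 (Y.1 - Z.1)) :=
    hkN.add (hkL.const_mul _)
  refine (lintegral_mono_ae hin).trans ?_
  simp_rw [hsum]
  rw [lintegral_const_mul _ hks, lintegral_add_left hkN,
    lintegral_const_mul _ hkL, mul_assoc]
  refine mul_le_mul_right (mul_le_mul_right ?_ _) _
  exact add_le_add (lintegral_kerIn_incNorm_le h₁ h₂ hε hg Y)
    (mul_le_mul_right (lintegral_kerIn_gradSeg_le h₁ h₂ hε hΩ hG Y) _)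

end Estimate

section Holder

variable {d : ℕ} {φ₁ : ℝ → ℝ} {φ₂ : Esp d → ℝ} {ε : ℝ} {Ω : Set (Esp d)} {T : ℝ}
  {g : Esp d → ℝ → Esp d → ℝ → ℝ} {G : Esp d → ℝ → Esp d → ℝ → Esp d}

lemma lintegral_mul_mul_le_mixed {q₁ q₂ q₃ p₁ p₂ p₃ : ℝ≥0∞} (hq₁ : q₁ ≠ 0) (hq₂ : q₂ ≠ 0)
    (hq₃ : q₃ ≠ 0) (hp₁ : p₁ ≠ 0) (hp₂ : p₂ ≠ 0) (hp₃ : p₃ ≠ 0)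
    (hq : q₁⁻¹ + q₂⁻¹ + q₃⁻¹ = 1) (hp : p₁⁻¹ + p₂⁻¹ + p₃⁻¹ = 1)
    {a b c : Esp d × ℝ → ℝ≥0∞} (ha : Measurable a) (hb : Measurable b) (hc : Measurable c) :
    ∫⁻ X, a X * b X * c X ≤
      (eLp q₁ volume fun t => eLp p₁ volume fun x => a (x, t)) *
        (eLp q₂ volume fun t => eLp p₂ volume fun x => b (x, t)) *
        eLp q₃ volume fun t => eLp p₃ volume fun x => c (x, t) := by
  have hne : ∀ {r r' : ℝ≥0∞}, r ≠ 0 → r' ≠ 0 → (r⁻¹ + r'⁻¹)⁻¹ ≠ 0 := fun h h' => by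
    simp [h, h']
  have hm : Measurable fun X => a X * b X * c X := (ha.mul hb).mul hc
  rw [Measure.volume_eq_prod, lintegral_prod_symm' _ hm, ← eLp_one]
  simp_rw [← eLp_one (μ := (volume : Measure (Esp d)))]
  refine (eLp_mixed_mul_le (a := fun X => a X * b X) (hne hq₁ hq₂) (hne hp₁ hp₂) hq₃ hp₃
    (by rw [inv_inv, hq, inv_one]) (by rw [inv_inv, hp, inv_one]) (ha.mul hb) hc).trans ?_
  exact mul_le_mul_left (eLp_mixed_mul_le hq₁ hp₁ hq₂ hp₂ (inv_inv _) (inv_inv _) ha hb) _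

lemma eLp_timeInc_le (h₁ : GoodK1 φ₁) (hε : 0 < ε) {M : ℝ} (hM0 : 0 < M) (hM : ∀ s, φ₁ s ≤ M)
    (hg : Meas4 g) :
    (eLp 2 volume fun t => eLp ⊤ (volume : Measure (Esp d)) fun _ => timeInc φ₁ ε Ω T g t) ≤
      ENNReal.ofReal M ^ (1 / 2 : ℝ) * ENNReal.ofReal ε *
        fracSemi 2 (Ioo 0 T) (incNorm Ω g) := by
  refine le_trans (eLp_mono_ae (g := timeInc φ₁ ε Ω T g)
    (Filter.Eventually.of_forall fun t => ?_)) ?_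
  · rw [eLp_top]
    exact essSup_le_of_ae_le _ (Filter.Eventually.of_forall fun _ => le_rfl)
  · refine le_trans (le_of_eq ?_)
      (eLp_time_increment_le h₁ hε hM0 hM (Ioo 0 T) (measurable_incNorm (Ω := Ω) hg))
    exact eLp_indicator two_ne_zero measurableSet_Ioo _

lemma eLp_gradMean_le (h₂ : GoodK2 φ₂) (hε : 0 < ε) (hd : 1 ≤ d) (hΩ : IsOpen Ω)
    (hG : Measurable fun w : (Esp d × ℝ) × Esp d × ℝ => G w.1.1 w.1.2 w.2.1 w.2.2) :
    (eLp ⊤ volume fun t => eLp (d : ℝ≥0∞) volume fun x => gradMean φ₂ ε Ω T G (x, t)) ≤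
      mixNorm ⊤ (d : ℝ≥0∞) (timeSpace Ω T) (gradNorm G) := by
  have hd' : (1 : ℝ≥0∞) ≤ d := by exact_mod_cast hd
  rw [mixNorm_eq_indicator (zero_lt_one.trans_le hd').ne' (measurableSet_timeSpace hΩ)]
  refine eLp_mono_ae (Filter.Eventually.of_forall fun t => ?_)
  exact eLp_segment_mean_le h₂ hε hd'
    (W := fun x => (timeSpace Ω T).indicator (fun X => gradNorm G X.1 X.2) (x, t))
    (((measurable_gradNorm hG).indicator (measurableSet_timeSpace hΩ)).comp
      (measurable_id.prodMk measurable_const))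

lemma eLp_sqMean_le (h₁ : GoodK1 φ₁) (h₂ : GoodK2 φ₂) (hε : 0 < ε) (hΩ : IsOpen Ω) {q p : ℝ≥0∞}
    (hq : 2 ≤ q) (hp : 2 ≤ p) {b : Esp d × ℝ → ℝ≥0∞} (hb : Measurable b)
    (hbs : ∀ X ∉ timeSpace Ω T, b X = 0) :
    (eLp q volume fun t => eLp p volume fun x => sqMean φ₁ φ₂ ε b (x, t)) ≤
      mixNorm q p (timeSpace Ω T) fun x t => b (x, t) := by
  rw [mixNorm_eq_indicator (two_pos.trans_le hp).ne' (measurableSet_timeSpace hΩ),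
    indicator_eq_self.2 (Function.support_subset_iff'.2 hbs)]
  exact eLp_mixed_smoothing_sq_le h₁ h₂ hε hq hp hb

lemma lintegral_commutator_majorant_le (hd : 1 ≤ d) (h₁ : GoodK1 φ₁) (h₂ : GoodK2 φ₂) (hε : 0 < ε)
    {M : ℝ} (hM0 : 0 < M) (hM : ∀ s, φ₁ s ≤ M) (hΩ : IsOpen Ω) (hg : Meas4 g)
    (hG : Measurable fun w : (Esp d × ℝ) × Esp d × ℝ => G w.1.1 w.1.2 w.2.1 w.2.2)
    {F : Esp d → ℝ → ℝ≥0∞} (hF : Measurable fun X : Esp d × ℝ => F X.1 X.2)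
    {b : Esp d × ℝ → ℝ≥0∞} (hb : Measurable b) (hbs : ∀ X ∉ timeSpace Ω T, b X = 0)
    {q p : ℝ≥0∞} (hq : 2 ≤ q) (hp1 : 1 ≤ p) (hp2 : p ≤ 2) (hpd : p < d) :
    ∫⁻ Y, (timeSpace Ω T).indicator (fun X => F X.1 X.2) Y * sqMean φ₁ φ₂ ε b Y *
        (timeInc φ₁ ε Ω T g Y.2 + ENNReal.ofReal ε * gradMean φ₂ ε Ω T G Y) ≤
      mixNorm ((1/2 - 1/q)⁻¹) 2 (timeSpace Ω T) F *
          mixNorm q 2 (timeSpace Ω T) (fun x t => b (x, t)) *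
          (ENNReal.ofReal M ^ (1 / 2 : ℝ) * ENNReal.ofReal ε *
            fracSemi 2 (Ioo 0 T) (incNorm Ω g)) +
        ENNReal.ofReal ε * (mixNorm 2 ((1/p - 1/(d : ℝ≥0∞))⁻¹) (timeSpace Ω T) F *
          mixNorm 2 ((1 - 1/p)⁻¹) (timeSpace Ω T) (fun x t => b (x, t)) *
          mixNorm ⊤ (d : ℝ≥0∞) (timeSpace Ω T) (gradNorm G)) := by
  have hT := measurableSet_timeSpace (T := T) hΩ
  have hFm : Measurable ((timeSpace Ω T).indicator fun X => F X.1 X.2) := hF.indicator hT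
  have hsm := measurable_sqMean (ε := ε) h₁ h₂ hb
  have hnm : Measurable fun Y : Esp d × ℝ => timeInc φ₁ ε Ω T g Y.2 :=
    (measurable_timeInc h₁ hg).comp measurable_snd
  have hUm := measurable_gradMean (T := T) (ε := ε) h₂ hΩ hG
  have hp0 : p ≠ 0 := (zero_lt_one.trans_le hp1).ne'
  have hq0 : q ≠ 0 := (two_pos.trans_le hq).ne'
  have hd0 : (d : ℝ≥0∞) ≠ 0 := by exact_mod_cast (Nat.one_le_iff_ne_zero.1 hd)
  have hr1 : (1 / 2 - 1 / q : ℝ≥0∞)⁻¹ ≠ 0 :=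
    ENNReal.inv_ne_zero.2 (ne_top_of_le_ne_top (by simp) tsub_le_self)
  have hr2 : (1 / p - 1 / (d : ℝ≥0∞))⁻¹ ≠ 0 :=
    ENNReal.inv_ne_zero.2 (ne_top_of_le_ne_top (by simp [hp0]) tsub_le_self)
  have hr3 : 2 ≤ (1 - 1 / p : ℝ≥0∞)⁻¹ := by
    rw [ENNReal.le_inv_iff_le_inv, tsub_le_iff_right]
    calc (1 : ℝ≥0∞) = 2⁻¹ + 2⁻¹ := ENNReal.inv_two_add_inv_two.symm
      _ ≤ 2⁻¹ + 1 / p := by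
        rw [one_div]
        gcongr
  have hN := lintegral_mul_mul_le_mixed hr1 hq0 two_ne_zero two_ne_zero two_ne_zero top_ne_zero
    (by
      rw [inv_inv, one_div q, tsub_add_cancel_of_le, one_div, ENNReal.inv_two_add_inv_two]
      rw [one_div]
      exact ENNReal.inv_le_inv.2 hq)
    (by rw [ENNReal.inv_top, add_zero, ENNReal.inv_two_add_inv_two]) hFm hsm hnm
  have hV := lintegral_mul_mul_le_mixed two_ne_zero two_ne_zero top_ne_zero hr2
    (two_pos.trans_le hr3).ne' hd0
    (by rw [ENNReal.inv_top, add_zero, ENNReal.inv_two_add_inv_two])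
    (by
      have hpd' : (d : ℝ≥0∞)⁻¹ ≤ p⁻¹ := ENNReal.inv_le_inv.2 hpd.le
      have hp1' : p⁻¹ ≤ 1 := ENNReal.inv_le_one.2 hp1
      rw [inv_inv, inv_inv, one_div, one_div, add_right_comm, tsub_add_cancel_of_le hpd',
        add_tsub_cancel_of_le hp1']) hFm hsm hUm
  rw [← mixNorm_eq_indicator two_ne_zero hT] at hN
  rw [← mixNorm_eq_indicator hr2 hT] at hV
  simp_rw [mul_add, mul_left_comm _ (ENNReal.ofReal ε)]
  have hA : Measurable fun Y => (timeSpace Ω T).indicator (fun X => F X.1 X.2) Y *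
      sqMean φ₁ φ₂ ε b Y * timeInc φ₁ ε Ω T g Y.2 := (hFm.mul hsm).mul hnm
  have hB : Measurable fun Y => (timeSpace Ω T).indicator (fun X => F X.1 X.2) Y *
      sqMean φ₁ φ₂ ε b Y * gradMean φ₂ ε Ω T G Y := (hFm.mul hsm).mul hUm
  rw [lintegral_add_left hA, lintegral_const_mul _ hB]
  refine add_le_add (hN.trans ?_) (mul_le_mul_right (hV.trans ?_) _)
  · exact mul_le_mul' (mul_le_mul_right (eLp_sqMean_le h₁ h₂ hε hΩ hq le_rfl hb hbs) _)
      (eLp_timeInc_le h₁ hε hM0 hM hg)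
  · exact mul_le_mul' (mul_le_mul_right (eLp_sqMean_le h₁ h₂ hε hΩ le_rfl hr3 hb hbs) _)
      (eLp_gradMean_le h₂ hε hd hΩ hG)

end Holder

theorem stmt_8 (d : ℕ) (hd : 2 ≤ d) (φ₁ : ℝ → ℝ) (φ₂ : Esp d → ℝ)
    (hφ₁ : GoodK1 φ₁) (hφ₂ : GoodK2 φ₂) (q s : ℝ≥0∞) (hq : 2 ≤ q) (hs : 2 < s) :
    ∃ C : ℝ≥0∞, C ≠ ∞ ∧
      ∀ (Ω : Set (Esp d)), IsOpen Ω → Bornology.IsBounded Ω → ∀ T : ℝ, 0 < T →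
      ∀ ε : ℝ, 0 < ε → ∀ p : ℝ≥0∞, 1 ≤ p → p ≤ 2 → p < (d : ℝ≥0∞) →
      ∀ (g f h : Esp d → ℝ → Esp d → ℝ → ℝ) (G : Esp d → ℝ → Esp d → ℝ → Esp d)
        (ψ : Esp d × ℝ → ℝ),
        Meas4 g → Meas4 f → Meas4 h → Per4 g → Per4 f → Per4 h →
        (∃ M : ℝ, ∀ x t y τ, |g x t y τ| ≤ M) →
        Measurable (fun w : (Esp d × ℝ) × Esp d × ℝ => G w.1.1 w.1.2 w.2.1 w.2.2) →
        (∀ᵐ w : ℝ × Esp d × ℝ ∂((volume.restrict (Ioo (0:ℝ) T)).prod volume),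
          IsWeakGradOn Ω (fun x => g x w.1 w.2.1 w.2.2) (fun x => G x w.1 w.2.1 w.2.2)) →
        HSemi Ω T g G < ∞ →
        mixNorm ⊤ ⊤ (timeSpace Ω T) (fun x t => cellNorm s 2 (h x t)) < ∞ →
        mixNorm 2 ((1/p - 1/(d : ℝ≥0∞))⁻¹) (timeSpace Ω T)
            (fun x t => cellNorm ⊤ ⊤ (f x t)) < ∞ →
        mixNorm ((1/2 - 1/q)⁻¹) 2 (timeSpace Ω T) (fun x t => cellNorm ⊤ ⊤ (f x t)) < ∞ →
        ContDiff ℝ (⊤ : ℕ∞) ψ → HasCompactSupport ψ → tsupport ψ ⊆ timeSpace Ω T →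
        mixNorm 1 1 (timeSpace Ω T \ blayer Ω T 1 ε)
            (fun x t => (‖osc4 ε (S4 φ₁ φ₂ ε (fun a b c e =>
                (g a b c e * S4 φ₁ φ₂ ε h a b c e -
                  S4 φ₁ φ₂ ε (fun a' b' c' e' => g a' b' c' e' * h a' b' c' e') a b c e) *
                  f a b c e)) x t *
              ψ (x, t)‖₊ : ℝ≥0∞)) ≤
          C * ENNReal.ofReal ε * HSemi Ω T g G *
            mixNorm ⊤ ⊤ (timeSpace Ω T) (fun x t => cellNorm s 2 (h x t)) *
            (mixNorm 2 ((1/p - 1/(d : ℝ≥0∞))⁻¹) (timeSpace Ω T)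
                  (fun x t => cellNorm ⊤ ⊤ (f x t)) *
                mixNorm 2 ((1 - 1/p)⁻¹) (timeSpace Ω T)
                  (fun x t => (‖ψ (x, t)‖₊ : ℝ≥0∞)) +
              mixNorm ((1/2 - 1/q)⁻¹) 2 (timeSpace Ω T) (fun x t => cellNorm ⊤ ⊤ (f x t)) *
                mixNorm q 2 (timeSpace Ω T) (fun x t => (‖ψ (x, t)‖₊ : ℝ≥0∞))) := by
  have hb₁ := hφ₁.1.continuous
  have hb₂ := hφ₂.1.continuous
  obtain ⟨A₁, hA₁⟩ := hφ₁.2.1.exists_bound_of_continuous hb₁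
  obtain ⟨M₂, hA₂⟩ := hφ₂.2.1.exists_bound_of_continuous hb₂
  set M₁ : ℝ := A₁ + 1
  have hM₁ : ∀ r, φ₁ r ≤ M₁ := fun r => ((le_abs_self _).trans (hA₁ r)).trans (by linarith)
  have hM₂ : ∀ y, φ₂ y ≤ M₂ := fun y => (le_abs_self _).trans (hA₂ y)
  have hM₁0 : 0 < M₁ := by linarith [(norm_nonneg _).trans (hA₁ 0)]
  have hd1 : 1 ≤ d := one_le_two.trans hd
  refine ⟨(ENNReal.ofReal M₁ * ENNReal.ofReal M₂) ^ (1 / 2 : ℝ) *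
    (ENNReal.ofReal M₁ ^ (1 / 2 : ℝ) + 1), ?_, ?_⟩
  · exact ENNReal.mul_ne_top
      (ENNReal.rpow_ne_top_of_nonneg (by norm_num)
        (ENNReal.mul_ne_top ENNReal.ofReal_ne_top ENNReal.ofReal_ne_top))
      (ENNReal.add_ne_top.2
        ⟨ENNReal.rpow_ne_top_of_nonneg (by norm_num) ENNReal.ofReal_ne_top, ENNReal.one_ne_top⟩)
  intro Ω hΩ hΩb T _ ε hε p hp1 hp2 hpd g f h G ψ hg hf hh hgp hfp hhp ⟨M, hM⟩ hG hw hS hH _ _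
    hψ _ hψΩ
  have hψm : Measurable ψ := hψ.continuous.measurable
  have hbm : Measurable fun X => ‖ψ X‖ₑ := hψm.enorm
  have hbs : ∀ X ∉ timeSpace Ω T, ‖ψ X‖ₑ = 0 := fun X hX => by
    rw [image_eq_zero_of_notMem_tsupport fun hX' => hX (hψΩ hX'), enorm_zero]
  have hfrac : fracSemi 2 (Ioo 0 T) (incNorm Ω g) ≤ HSemi Ω T g G := le_self_add
  have hgrad : mixNorm ⊤ (d : ℝ≥0∞) (timeSpace Ω T) (gradNorm G) ≤ HSemi Ω T g G := le_add_self
  have hker := lintegral_smoothed_commutator_le hφ₁ hφ₂ hε hΩ hΩb hg hf hh hhp hM hψm hs.le hH.ne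
  have hmaj := lintegral_lintegral_commKer_le hd1 hφ₁ hφ₂ hε hM₁ hM₂ hΩ hΩb hg hgp hM hG hw
    (hgrad.trans_lt hS).ne hf hfp hh hhp hbm hs.le
  have hmix := lintegral_commutator_majorant_le (g := g) (F := fun x t => cellNorm ⊤ ⊤ (f x t))
    hd1 hφ₁ hφ₂ hε hM₁0 hM₁ hΩ hg hG
    (measurable_cellNorm (a := fun X : Esp d × ℝ => f X.1 X.2) hf) hbm hbs hq hp1 hp2 hpd
  refine (hker.trans hmaj).trans ((mul_le_mul_right (hmix.trans (add_le_add
    (mul_le_mul_right (mul_le_mul_right hfrac _) _)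
    (mul_le_mul_right (mul_le_mul_right hgrad _) _))) _).trans ?_)
  set K := (ENNReal.ofReal M₁ * ENNReal.ofReal M₂) ^ (1 / 2 : ℝ)
  set κ := ENNReal.ofReal M₁ ^ (1 / 2 : ℝ)
  set N := HSemi Ω T g G
  set H := mixNorm ⊤ ⊤ (timeSpace Ω T) fun x t => cellNorm s 2 (h x t)
  set e := ENNReal.ofReal ε
  set F₁ := mixNorm ((1/2 - 1/q)⁻¹) 2 (timeSpace Ω T) fun x t => cellNorm ⊤ ⊤ (f x t)
  set F₂ := mixNorm 2 ((1/p - 1/(d : ℝ≥0∞))⁻¹) (timeSpace Ω T) fun x t => cellNorm ⊤ ⊤ (f x t)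
  change K * H * (F₁ * mixNorm q 2 (timeSpace Ω T) (fun x t => (‖ψ (x, t)‖₊ : ℝ≥0∞)) *
      (κ * e * N) +
    e * (F₂ * mixNorm 2 ((1 - 1/p)⁻¹) (timeSpace Ω T) (fun x t => (‖ψ (x, t)‖₊ : ℝ≥0∞)) * N)) ≤ _
  set B₁ := mixNorm q 2 (timeSpace Ω T) fun x t => (‖ψ (x, t)‖₊ : ℝ≥0∞)
  set B₂ := mixNorm 2 ((1 - 1/p)⁻¹) (timeSpace Ω T) fun x t => (‖ψ (x, t)‖₊ : ℝ≥0∞)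
  calc K * H * (F₁ * B₁ * (κ * e * N) + e * (F₂ * B₂ * N))
      = K * H * e * N * (κ * (F₁ * B₁) + 1 * (F₂ * B₂)) := by ring
    _ ≤ K * H * e * N * ((κ + 1) * (F₁ * B₁) + (κ + 1) * (F₂ * B₂)) := by
        gcongr
        · exact le_self_add
        · exact le_add_self
    _ = K * (κ + 1) * e * N * H * (F₂ * B₂ + F₁ * B₁) := by ring

end
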